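/- arXiv:1012.4221 — 4 statements merged into one kernel-verified Lean document; each statement's English description precedes it below -/
import Mathlib

section
/- Let k > 1, let n₁ ≥ ⋯ ≥ n_k ≥ 2 be positive integers, let N = ∏_{i=1}^k n_i, and let Ψ : H_N → H_N be an ℝ-linear map on the space of N×N Hermitian matrices. Then Ψ maps the set of pure product states onto itself, i.e. Ψ(⊗_{i=1}^k P_{n_i}) = ⊗_{i=1}^k P_{n_i}, if and only if Ψ maps the set of multipartite separable states onto itself, i.e. Ψ(conv(⊗_{i=1}^k P_{n_i})) = conv(⊗_{i=1}^k P_{n_i}). -/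
open Matrix

/-- A pure state: a rank-one Hermitian matrix of trace one. -/
def IsPureState {m : ℕ} (A : Matrix (Fin m) (Fin m) ℂ) : Prop :=
  A.IsHermitian ∧ A.rank = 1 ∧ A.trace = 1

/-- The tensor (Kronecker) product `⊗_{i=1}^k A_i` of matrices `A_i` of sizes `n_i × n_i`:
the `N × N` matrix (`N = ∏ n_i`) with entries
`(⊗ A_i)((x₁,…,x_k),(y₁,…,y_k)) = ∏_i A_i(x_i, y_i)`. -/
def tensorPi {k : ℕ} {n : Fin k → ℕ} (A : ∀ i, Matrix (Fin (n i)) (Fin (n i)) ℂ) :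
    Matrix (∀ i, Fin (n i)) (∀ i, Fin (n i)) ℂ :=
  Matrix.of fun x y => ∏ i, A i (x i) (y i)

/-- The set of pure product states `⊗_{i=1}^k P_{n_i}` inside `H_N`. -/
def PureTensor {k : ℕ} (n : Fin k → ℕ) :
    Set (selfAdjoint (Matrix (∀ i, Fin (n i)) (∀ i, Fin (n i)) ℂ)) :=
  {C | ∃ Q : ∀ i, Matrix (Fin (n i)) (Fin (n i)) ℂ, (∀ i, IsPureState (Q i)) ∧
    (C : Matrix (∀ i, Fin (n i)) (∀ i, Fin (n i)) ℂ) = tensorPi Q}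

lemma pure_norm_sq {m : ℕ} {Q : Matrix (Fin m) (Fin m) ℂ} (h : IsPureState Q) :
    ∑ x, ∑ y, ‖Q x y‖ ^ 2 = 1 := by
  obtain ⟨hH, hr, ht⟩ := h
  rw [Matrix.rank] at hr
  obtain ⟨v, hv⟩ := finrank_le_one_iff.mp hr.le
  have hc : ∀ y, ∃ c : ℂ, ∀ x, Q x y = c * (v : Fin m → ℂ) x := by
    intro y
    obtain ⟨c, hc⟩ := hv ⟨Q.mulVecLin (Pi.single y 1), LinearMap.mem_range_self _ _⟩
    refine ⟨c, fun x => ?_⟩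
    have := congrFun (congrArg Subtype.val hc) x
    simpa using this.symm
  choose c hc using hc
  have ht' : ∑ x, c x * (v : Fin m → ℂ) x = 1 := by
    rw [← ht, Matrix.trace]
    exact Finset.sum_congr rfl fun x _ => (hc x x).symm
  have key : ((∑ x, ∑ y, ‖Q x y‖ ^ 2 : ℝ) : ℂ) = 1 := by
    push_cast
    calc ∑ x, ∑ y, ((‖Q x y‖ : ℂ) ^ 2)
        = ∑ x, ∑ y, (c x * (v : Fin m → ℂ) x) * (c y * (v : Fin m → ℂ) y) := by
          refine Finset.sum_congr rfl fun x _ => Finset.sum_congr rfl fun y _ => ?_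
          rw [← Complex.mul_conj']
          have : (starRingEnd ℂ) (Q x y) = Q y x := hH.apply y x
          rw [this, hc x y, hc y x]; ring
      _ = 1 := by
          rw [← Finset.sum_mul_sum, ht', one_mul]
  exact_mod_cast key

/-- Entries of a Hermitian matrix as a Euclidean vector. -/
noncomputable def toEuc (I : Type) [Fintype I] [DecidableEq I] :
    selfAdjoint (Matrix I I ℂ) →ₗ[ℝ] EuclideanSpace ℂ (I × I) where
  toFun X := WithLp.toLp 2 fun p => (X : Matrix I I ℂ) p.1 p.2
  map_add' X Y := by ext p; simp
  map_smul' c X := by ext p; simp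

lemma toEuc_inj (I : Type) [Fintype I] [DecidableEq I] : Function.Injective (toEuc I) := by
  intro X Y h
  apply Subtype.ext
  ext x y
  have := congrArg (fun f : EuclideanSpace ℂ (I × I) => f (x, y)) h
  simpa [toEuc] using this

lemma norm_pureTensor {k : ℕ} {n : Fin k → ℕ}
    {C : selfAdjoint (Matrix (∀ i, Fin (n i)) (∀ i, Fin (n i)) ℂ)} (h : C ∈ PureTensor n) :
    ‖toEuc _ C‖ = 1 := by
  obtain ⟨Q, hQ, hC⟩ := h
  have : ‖toEuc _ C‖ ^ 2 = 1 := by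
    rw [EuclideanSpace.norm_sq_eq, Fintype.sum_prod_type]
    simp only [toEuc, LinearMap.coe_mk, AddHom.coe_mk, hC, tensorPi, Matrix.of_apply, norm_prod,
      ← Finset.prod_pow]
    have e : ∀ x : (∀ i, Fin (n i)), ∑ y : (∀ i, Fin (n i)), ∏ i, ‖Q i (x i) (y i)‖ ^ 2
        = ∏ i, ∑ b, ‖Q i (x i) b‖ ^ 2 := by
      intro x
      rw [Fintype.prod_sum]
    simp only [e]
    rw [← Fintype.prod_sum (fun i a => ∑ b, ‖Q i a b‖ ^ 2)]
    exact Finset.prod_eq_one fun i _ => pure_norm_sq (hQ i)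
  nlinarith [norm_nonneg (toEuc _ C)]

lemma norm_hull {k : ℕ} {n : Fin k → ℕ}
    {C : selfAdjoint (Matrix (∀ i, Fin (n i)) (∀ i, Fin (n i)) ℂ)}
    (h : C ∈ convexHull ℝ (PureTensor n)) : ‖toEuc _ C‖ ≤ 1 := by
  have hconv : Convex ℝ ((toEuc (∀ i, Fin (n i))) ⁻¹' Metric.closedBall 0 1) :=
    (convex_closedBall _ _).linear_preimage _
  have := convexHull_min (fun x hx => by simp [norm_pureTensor hx]) hconv h
  simpa using this

lemma pure_extreme {k : ℕ} {n : Fin k → ℕ}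
    {p x y : selfAdjoint (Matrix (∀ i, Fin (n i)) (∀ i, Fin (n i)) ℂ)}
    (hp : p ∈ PureTensor n) (hx : x ∈ convexHull ℝ (PureTensor n))
    (hy : y ∈ convexHull ℝ (PureTensor n)) {a b : ℝ} (ha : 0 < a) (hb : 0 < b) (hab : a + b = 1)
    (h : a • x + b • y = p) : x = p := by
  have hxy : x = y := by
    by_contra hne
    have := norm_combo_lt_of_ne (norm_hull hx) (norm_hull hy)
      (fun e => hne (toEuc_inj _ e)) ha hb hab
    rw [← map_smul, ← map_smul, ← map_add, h, norm_pureTensor hp] at this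
    exact lt_irrefl _ this
  rw [← h, ← hxy, ← add_smul, hab, one_smul]

/-- For `k > 1` and `n₁ ≥ ⋯ ≥ n_k ≥ 2`, an `ℝ`-linear map `Ψ` on `H_N` maps the pure
product states onto themselves, `Ψ(⊗_{i=1}^k P_{n_i}) = ⊗_{i=1}^k P_{n_i}`, if and only if
it maps the multipartite separable states onto themselves,
`Ψ(conv(⊗_{i=1}^k P_{n_i})) = conv(⊗_{i=1}^k P_{n_i})`. -/
theorem multipartite_pure_preserver_iff_sep_preserver (k : ℕ) (hk : 1 < k) (n : Fin k → ℕ)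
    (hmono : ∀ i j : Fin k, i ≤ j → n j ≤ n i) (h2 : ∀ i, 2 ≤ n i)
    (Ψ : selfAdjoint (Matrix (∀ i, Fin (n i)) (∀ i, Fin (n i)) ℂ) →ₗ[ℝ]
          selfAdjoint (Matrix (∀ i, Fin (n i)) (∀ i, Fin (n i)) ℂ)) :
    Ψ '' PureTensor n = PureTensor n ↔
      Ψ '' convexHull ℝ (PureTensor n) = convexHull ℝ (PureTensor n) := by
  have hlin : IsLinearMap ℝ Ψ := Ψ.isLinear
  constructor
  · intro h
    rw [Ψ.image_convexHull, h]
  · intro h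
    haveI : FiniteDimensional ℝ (selfAdjoint (Matrix (∀ i, Fin (n i)) (∀ i, Fin (n i)) ℂ)) :=
      FiniteDimensional.of_injective _ (toEuc_inj _)
    set C := convexHull ℝ (PureTensor n) with hC
    have hmap : (Submodule.span ℝ C).map Ψ = Submodule.span ℝ C := by
      rw [Submodule.map_span, h]
    have hinj : ∀ x ∈ C, ∀ y ∈ C, Ψ x = Ψ y → x = y := by
      have hV : ∀ x ∈ Submodule.span ℝ C, Ψ x ∈ Submodule.span ℝ C := fun x hx => by
        rw [← hmap]; exact Submodule.mem_map_of_mem hx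
      have hsurj : Function.Surjective (Ψ.restrict hV) := by
        rintro ⟨y, hy⟩
        have hy' := hy
        rw [← hmap] at hy'
        obtain ⟨x, hx, rfl⟩ := hy'
        exact ⟨⟨x, hx⟩, rfl⟩
      have hi := LinearMap.injective_iff_surjective.mpr hsurj
      intro x hx y hy hxy
      have := @hi ⟨x, Submodule.subset_span hx⟩ ⟨y, Submodule.subset_span hy⟩
        (Subtype.ext hxy)
      exact congrArg Subtype.val this
    have hcv : Convex ℝ C := convex_convexHull _ _
    have hsub : PureTensor n ⊆ C := subset_convexHull _ _
    apply Set.Subset.antisymm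
    · rintro _ ⟨p, hp, rfl⟩
      apply extremePoints_convexHull_subset (𝕜 := ℝ)
      refine mem_extremePoints_iff_left.mpr ⟨?_, ?_⟩
      · rw [← hC, ← h]; exact Set.mem_image_of_mem _ (hsub hp)
      · intro x hx y hy hxy
        rw [← hC, ← h] at hx hy
        obtain ⟨x, hx, rfl⟩ := hx
        obtain ⟨y, hy, rfl⟩ := hy
        obtain ⟨a, b, ha, hb, hab, e⟩ := hxy
        rw [← map_smul, ← map_smul, ← map_add] at e
        rw [pure_extreme hp hx hy ha hb hab
          (hinj _ (hcv hx hy ha.le hb.le hab) _ (hsub hp) e)]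
    · intro p hp
      have hp' := hsub hp
      rw [← h] at hp'
      obtain ⟨c, hc, rfl⟩ := hp'
      refine ⟨c, ?_, rfl⟩
      apply extremePoints_convexHull_subset (𝕜 := ℝ)
      refine mem_extremePoints_iff_left.mpr ⟨hc, ?_⟩
      intro x hx y hy hxy
      obtain ⟨a, b, ha, hb, hab, e⟩ := hxy
      have hΨ : ∀ z ∈ C, Ψ z ∈ C := fun z hz => by
        rw [← h]; exact Set.mem_image_of_mem _ hz
      refine hinj _ hx _ hc (pure_extreme hp (hΨ x hx) (hΨ y hy) ha hb hab ?_)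
      rw [← map_smul, ← map_smul, ← map_add, e]
end

section
/- Let k ≥ 1, let n₁,…,n_k ≥ 2 be positive integers, let N = ∏_{i=1}^k n_i, and let S = conv(⊗_{i=1}^k P_{n_i}) be the set of multipartite separable states. Then the matrix (1/N) I_N lies in the intrinsic (relative) interior of S and the dimension of S as a convex subset of H_N equals N² − 1. -/
open Matrix

/-- The set of multipartite separable states
`S = conv(⊗_{i=1}^k P_{n_i})`, inside the space of `N × N` matrices. -/
noncomputable def MultiSep {k : ℕ} (n : Fin k → ℕ) :
    Set (Matrix (∀ i, Fin (n i)) (∀ i, Fin (n i)) ℂ) :=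
  convexHull ℝ {C | ∃ Q : ∀ i, Matrix (Fin (n i)) (Fin (n i)) ℂ,
    (∀ i, IsPureState (Q i)) ∧ C = tensorPi Q}


lemma zero_mem_interior_of_absorb {E : Type*} [AddCommGroup E] [TopologicalSpace E]
    [IsTopologicalAddGroup E] [T2Space E] [Module ℝ E] [ContinuousSMul ℝ E]
    [FiniteDimensional ℝ E] (S : Set E) (hS : Convex ℝ S)
    (h : ∀ v : E, ∃ ε : ℝ, 0 < ε ∧ ε • v ∈ S) : (0 : E) ∈ interior S := by
  let e := toEuclidean (E := E)
  let S' : Set (EuclideanSpace ℝ (Fin (Module.finrank ℝ E))) := e.symm ⁻¹' S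
  have hS' : Convex ℝ S' := hS.linear_preimage e.symm.toLinearEquiv.toLinearMap
  have h' : ∀ v, ∃ ε : ℝ, 0 < ε ∧ ε • v ∈ S' := by
    intro v
    obtain ⟨ε, h0, h1⟩ := h (e.symm v)
    exact ⟨ε, h0, by simpa [S'] using h1⟩
  have h0 : (0 : EuclideanSpace ℝ (Fin (Module.finrank ℝ E))) ∈ S' := by
    obtain ⟨ε, _, h1⟩ := h' 0
    simpa using h1
  have hspan : affineSpan ℝ S' = ⊤ := by
    rw [eq_top_iff]
    intro v _
    obtain ⟨ε, he, h1⟩ := h' v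
    have := AffineMap.lineMap_mem (ε⁻¹) (subset_affineSpan ℝ S' h0) (subset_affineSpan ℝ S' h1)
    simpa [AffineMap.lineMap_apply, smul_smul, inv_mul_cancel₀ he.ne'] using this
  obtain ⟨p, hp⟩ := (hS'.interior_nonempty_iff_affineSpan_eq_top).2 hspan
  obtain ⟨ε, he, h1⟩ := h' (-p)
  have h2 : (0 : EuclideanSpace ℝ (Fin (Module.finrank ℝ E))) ∈ interior S' := by
    apply hS'.openSegment_interior_self_subset_interior hp h1
    refine ⟨ε / (1 + ε), 1 / (1 + ε), by positivity, by positivity, by field_simp; ring, ?_⟩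
    rw [smul_neg, smul_neg, smul_smul, one_div, div_eq_inv_mul, add_neg_cancel]
  have h3 : interior S' = e.symm ⁻¹' interior S := by
    exact (e.symm.toHomeomorph.preimage_interior S).symm
  rw [h3] at h2
  simpa using h2

lemma exists_spectral {m : ℕ} (A : Matrix (Fin m) (Fin m) ℂ) (hA : A.IsHermitian) :
    ∃ (l : Fin m → ℝ) (P : Fin m → Matrix (Fin m) (Fin m) ℂ), (∀ j, IsPureState (P j)) ∧
      (A = ∑ j, (l j : ℂ) • P j) ∧ (1 : Matrix (Fin m) (Fin m) ℂ) = ∑ j, P j := by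
  set U : Matrix (Fin m) (Fin m) ℂ := (hA.eigenvectorUnitary : Matrix (Fin m) (Fin m) ℂ) with hU
  have hU1 : star U * U = 1 := Unitary.coe_star_mul_self hA.eigenvectorUnitary
  have hU2 : U * star U = 1 := Unitary.coe_mul_star_self hA.eigenvectorUnitary
  have hs : A = U * diagonal (fun j => (hA.eigenvalues j : ℂ)) * star U := by
    have := hA.spectral_theorem
    rw [Unitary.conjStarAlgAut_apply] at this
    exact this
  refine ⟨hA.eigenvalues, fun j => vecMulVec (fun x => U x j) (fun y => star (U y j)), ?_, ?_, ?_⟩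
  · intro j
    have htr : (vecMulVec (fun x => U x j) (fun y => star (U y j))).trace = 1 := by
      have := congrFun (congrFun hU1 j) j
      simp only [Matrix.mul_apply, Matrix.star_apply, Matrix.one_apply_eq] at this
      rw [← this]
      simp [Matrix.trace, vecMulVec_apply, mul_comm]
    refine ⟨?_, ?_, htr⟩
    · ext x y
      simp [vecMulVec_apply, mul_comm]
    · have h1 := rank_vecMulVec_le (fun x => U x j) (fun y => star (U y j))
      have h2 : (vecMulVec (fun x => U x j) (fun y => star (U y j))).rank ≠ 0 := by
        intro h
        rw [Matrix.rank, Submodule.finrank_eq_zero, LinearMap.range_eq_bot] at h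
        have h' : vecMulVec (fun x => U x j) (fun y => star (U y j)) = 0 :=
          Matrix.toLin'.injective (by rw [map_zero]; exact h)
        rw [h'] at htr
        simp at htr
      exact le_antisymm h1 (Nat.one_le_iff_ne_zero.2 h2)
  · conv_lhs => rw [hs]
    ext x y
    rw [Matrix.mul_apply]
    simp only [Matrix.mul_diagonal, Matrix.sum_apply, Matrix.smul_apply, vecMulVec_apply, Matrix.star_apply, smul_eq_mul]
    exact Finset.sum_congr rfl fun j _ => by ring
  · rw [← hU2]
    ext x y
    simp [Matrix.mul_apply, Matrix.sum_apply, vecMulVec_apply]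

/-- Product pure states. -/
def prodStates {k : ℕ} (n : Fin k → ℕ) : Set (Matrix (∀ i, Fin (n i)) (∀ i, Fin (n i)) ℂ) :=
  {C | ∃ Q : ∀ i, Matrix (Fin (n i)) (Fin (n i)) ℂ, (∀ i, IsPureState (Q i)) ∧ C = tensorPi Q}

lemma tensorPi_sum {k : ℕ} {n : Fin k → ℕ} {ι : Fin k → Type} [∀ i, Fintype (ι i)]
    (A : ∀ i, ι i → Matrix (Fin (n i)) (Fin (n i)) ℂ) :
    tensorPi (fun i => ∑ j, A i j) = ∑ f : (∀ i, ι i), tensorPi (fun i => A i (f i)) := by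
  classical
  ext x y
  simp only [tensorPi, Matrix.of_apply, Matrix.sum_apply]
  rw [Finset.prod_univ_sum]
  simp

lemma tensorPi_smul {k : ℕ} {n : Fin k → ℕ} (c : Fin k → ℂ)
    (A : ∀ i, Matrix (Fin (n i)) (Fin (n i)) ℂ) :
    tensorPi (fun i => c i • A i) = (∏ i, c i) • tensorPi A := by
  ext x y
  simp [tensorPi, Finset.prod_mul_distrib]

lemma tensorPi_one {k : ℕ} {n : Fin k → ℕ} :
    tensorPi (fun i => (1 : Matrix (Fin (n i)) (Fin (n i)) ℂ)) = 1 := by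
  classical
  ext x y
  simp only [tensorPi, Matrix.of_apply, Matrix.one_apply, Finset.prod_ite_zero, funext_iff]
  simp

lemma tensorPi_trace {k : ℕ} {n : Fin k → ℕ} 
    (A : ∀ i, Matrix (Fin (n i)) (Fin (n i)) ℂ) :
    (tensorPi A).trace = ∏ i, (A i).trace := by
  classical
  simp only [Matrix.trace, tensorPi, Matrix.of_apply, Matrix.diag]
  rw [Finset.prod_univ_sum]
  simp

lemma tensorPi_herm {k : ℕ} {n : Fin k → ℕ} 
    (A : ∀ i, Matrix (Fin (n i)) (Fin (n i)) ℂ) (h : ∀ i, (A i).IsHermitian) :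
    (tensorPi A).IsHermitian := by
  ext x y
  simp only [tensorPi, Matrix.of_apply, Matrix.conjTranspose_apply, star_prod]
  exact Finset.prod_congr rfl fun i _ => (h i).apply _ _

/-- The cone generated by product pure states. -/
noncomputable def Kc {k : ℕ} (n : Fin k → ℕ) : Submodule NNReal (Matrix (∀ i, Fin (n i)) (∀ i, Fin (n i)) ℂ) :=
  Submodule.span NNReal (prodStates n)

/-- `c • 1 + X` lies in the cone for all large `c`. -/
def PP {k : ℕ} (n : Fin k → ℕ) (X : Matrix (∀ i, Fin (n i)) (∀ i, Fin (n i)) ℂ) : Prop :=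
  ∃ c0 : ℝ, ∀ c : ℝ, c0 ≤ c → (c : ℂ) • (1 : Matrix (∀ i, Fin (n i)) (∀ i, Fin (n i)) ℂ) + X ∈ Kc n

lemma Kc_smul {k : ℕ} {n : Fin k → ℕ} {X} (h : X ∈ Kc n) (r : ℝ) (hr : 0 ≤ r) :
    (r : ℂ) • X ∈ Kc n := by
  have := (Kc n).smul_mem r.toNNReal h
  rw [NNReal.smul_def, Real.coe_toNNReal r hr] at this
  exact this

lemma PP_herm {k : ℕ} {n : Fin k → ℕ} (A : ∀ i, Matrix (Fin (n i)) (Fin (n i)) ℂ)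
    (h : ∀ i, (A i).IsHermitian) (r : ℝ) : PP n ((r : ℂ) • tensorPi A) := by
  classical
  choose l P hP hA h1 using fun i => exists_spectral (A i) (h i)
  have e1 : tensorPi A = ∑ f : (∀ i, Fin (n i)), ((∏ i, l i (f i) : ℝ) : ℂ) •
      tensorPi (fun i => P i (f i)) := by
    have : A = fun i => ∑ j, (l i j : ℂ) • P i j := funext hA
    rw [this, tensorPi_sum]
    refine Finset.sum_congr rfl fun f _ => ?_
    rw [tensorPi_smul]
    push_cast
    rfl
  have e2 : (1 : Matrix (∀ i, Fin (n i)) (∀ i, Fin (n i)) ℂ) =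
      ∑ f : (∀ i, Fin (n i)), tensorPi (fun i => P i (f i)) := by
    rw [← tensorPi_sum, ← tensorPi_one]
    congr 1
    exact funext h1
  refine ⟨∑ f : (∀ i, Fin (n i)), |r * ∏ i, l i (f i)|, fun c hc => ?_⟩
  have e3 : (c : ℂ) • (1 : Matrix (∀ i, Fin (n i)) (∀ i, Fin (n i)) ℂ) + (r : ℂ) • tensorPi A
      = ∑ f : (∀ i, Fin (n i)), ((c + r * ∏ i, l i (f i) : ℝ) : ℂ) •
        tensorPi (fun i => P i (f i)) := by
    rw [e1, e2, Finset.smul_sum, Finset.smul_sum, ← Finset.sum_add_distrib]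
    refine Finset.sum_congr rfl fun f _ => ?_
    rw [smul_smul, ← add_smul]
    push_cast
    rfl
  rw [e3]
  refine Submodule.sum_mem _ fun f _ => Kc_smul (Submodule.subset_span ⟨_, fun i => hP i (f i), rfl⟩) _ ?_
  have h4 : |r * ∏ i, l i (f i)| ≤ c := le_trans
    (Finset.single_le_sum (f := fun f : (∀ i, Fin (n i)) => |r * ∏ i, l i (f i)|)
      (fun _ _ => abs_nonneg _) (Finset.mem_univ f)) hc
  linarith [neg_abs_le (r * ∏ i, l i (f i))]

lemma PP_zero {k : ℕ} {n : Fin k → ℕ} : PP n 0 := by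
  have := PP_herm (n := n) (fun i => 1) (fun i => Matrix.isHermitian_one) 0
  simpa using this

lemma PP_add {k : ℕ} {n : Fin k → ℕ} {X Y} (hX : PP n X) (hY : PP n Y) : PP n (X + Y) := by
  obtain ⟨a, ha⟩ := hX
  obtain ⟨b, hb⟩ := hY
  refine ⟨a + b, fun c hc => ?_⟩
  have := (Kc n).add_mem (ha a le_rfl) (hb (c - a) (by linarith))
  convert this using 1
  push_cast
  rw [sub_smul]
  abel

lemma PP_sum {k : ℕ} {n : Fin k → ℕ} {ι : Type*} (s : Finset ι) (X : ι → _)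
    (h : ∀ i ∈ s, PP n (X i)) : PP n (∑ i ∈ s, X i) :=
  Finset.sum_induction _ _ (fun _ _ => PP_add) PP_zero h

lemma PP_tensor {k : ℕ} {n : Fin k → ℕ} (B : ∀ i, Matrix (Fin (n i)) (Fin (n i)) ℂ) (c : ℂ) :
    PP n (c • tensorPi B + (c • tensorPi B)ᴴ) := by
  classical
  let H : ∀ i, Bool → Matrix (Fin (n i)) (Fin (n i)) ℂ := fun i b =>
    if b then (1 / 2 : ℂ) • (B i + (B i)ᴴ) else (-Complex.I / 2) • (B i - (B i)ᴴ)
  let z : Bool → ℂ := fun b => if b then 1 else Complex.I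
  have hH : ∀ i b, (H i b).IsHermitian := by
    intro i b
    ext x y
    cases b
    · simp [H]; ring
    · simp [H]; ring
  have hB : B = fun i => ∑ b, z b • H i b := by
    funext i
    ext x y
    simp [H, z]
    linear_combination (1/2) * (B i x y - (starRingEnd ℂ) (B i y x)) * Complex.I_mul_I
  have e : tensorPi B = ∑ f : Fin k → Bool, (∏ i, z (f i)) • tensorPi (fun i => H i (f i)) := by
    conv_lhs => rw [hB, tensorPi_sum]
    exact Finset.sum_congr rfl fun f _ => tensorPi_smul _ _
  have e2 : c • tensorPi B + (c • tensorPi B)ᴴ = ∑ f : Fin k → Bool,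
      ((2 * (c * ∏ i, z (f i)).re : ℝ) : ℂ) • tensorPi (fun i => H i (f i)) := by
    rw [e, Finset.smul_sum, Matrix.conjTranspose_sum, ← Finset.sum_add_distrib]
    refine Finset.sum_congr rfl fun f _ => ?_
    rw [smul_smul, Matrix.conjTranspose_smul, (tensorPi_herm _ fun i => hH i (f i)).eq, ← add_smul]
    congr 1
    exact Complex.add_conj _
  rw [e2]
  exact PP_sum _ _ fun f _ => PP_herm _ (fun i => hH i (f i)) _

lemma PP_of_herm {k : ℕ} {n : Fin k → ℕ} (X : Matrix (∀ i, Fin (n i)) (∀ i, Fin (n i)) ℂ)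
    (hX : X.IsHermitian) : PP n X := by
  classical
  have hs : ∀ x y : (∀ i, Fin (n i)), tensorPi (fun i => Matrix.single (x i) (y i) (1 : ℂ)) = Matrix.single x y 1 := by
    intro x y
    ext a b
    simp only [tensorPi, Matrix.of_apply, Matrix.single_apply, Finset.prod_ite_zero, funext_iff]
    simp [forall_and]
  have e : X = ∑ x, ∑ y, ((X x y / 2) • tensorPi (fun i => Matrix.single (x i) (y i) (1 : ℂ)) +
      ((X x y / 2) • tensorPi (fun i => Matrix.single (x i) (y i) (1 : ℂ)))ᴴ) := by
    have e1 : (1 / 2 : ℂ) • X = ∑ x, ∑ y, ((X x y / 2) • tensorPi (fun i => Matrix.single (x i) (y i) (1 : ℂ))) := by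
      conv_lhs => rw [Matrix.matrix_eq_sum_single X]
      simp only [Finset.smul_sum, hs, Matrix.smul_single, smul_eq_mul, mul_one]
      simp [div_eq_inv_mul]
    have e2 : X = (1 / 2 : ℂ) • X + ((1 / 2 : ℂ) • X)ᴴ := by
      rw [Matrix.conjTranspose_smul, hX.eq, ← add_smul]
      norm_num
    conv_lhs => rw [e2, e1]
    simp only [Matrix.conjTranspose_sum, Finset.sum_add_distrib]
  rw [e]
  exact PP_sum _ _ fun x _ => PP_sum _ _ fun y _ => PP_tensor _ _

lemma prodStates_herm {k : ℕ} {n : Fin k → ℕ} {X} (h : X ∈ prodStates n) :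
    X.IsHermitian ∧ X.trace = 1 := by
  obtain ⟨Q, hQ, rfl⟩ := h
  exact ⟨tensorPi_herm _ fun i => (hQ i).1, by rw [tensorPi_trace]; simp [fun i => (hQ i).2.2]⟩

lemma multiSep_herm {k : ℕ} {n : Fin k → ℕ} {X} (h : X ∈ MultiSep n) :
    X.IsHermitian ∧ X.trace = 1 := by
  have hc : Convex ℝ {X : Matrix (∀ i, Fin (n i)) (∀ i, Fin (n i)) ℂ | X.IsHermitian ∧ X.trace = 1} := by
    intro X hX Y hY a b _ _ hab
    refine ⟨(hX.1.smul (IsSelfAdjoint.all a)).add (hY.1.smul (IsSelfAdjoint.all b)), ?_⟩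
    rw [Matrix.trace_add, Matrix.trace_smul, Matrix.trace_smul, hX.2, hY.2, ← add_smul, hab, one_smul]
  exact convexHull_min (fun _ => prodStates_herm) hc h

lemma Kc_mem {k : ℕ} {n : Fin k → ℕ} {X} (h : X ∈ Kc n) :
    X = 0 ∨ ∃ t : ℝ, 0 < t ∧ ∃ s ∈ MultiSep n, X = t • s := by
  have hc : Convex ℝ (MultiSep n) := convex_convexHull ℝ _
  induction h using Submodule.span_induction with
  | mem x hx => exact Or.inr ⟨1, one_pos, x, subset_convexHull ℝ _ hx, by simp⟩
  | zero => exact Or.inl rfl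
  | add x y _ _ hx hy =>
    rcases hx with rfl | ⟨t, ht, s, hs, rfl⟩
    · simpa using hy
    rcases hy with rfl | ⟨t', ht', s', hs', rfl⟩
    · exact Or.inr ⟨t, ht, s, hs, by simp⟩
    refine Or.inr ⟨t + t', by positivity, _, hc hs hs' (a := t / (t + t')) (b := t' / (t + t'))
      (by positivity) (by positivity) (by field_simp), ?_⟩
    rw [smul_add, smul_smul, smul_smul, mul_div_cancel₀ _ (by positivity), mul_div_cancel₀ _ (by positivity)]
  | smul a x _ hx =>
    rcases hx with rfl | ⟨t, ht, s, hs, rfl⟩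
    · left; simp
    rcases eq_or_ne a 0 with rfl | ha
    · left; simp
    right
    exact ⟨a * t, mul_pos (NNReal.coe_pos.2 (pos_iff_ne_zero.2 ha)) ht, s, hs, by
      rw [NNReal.smul_def, smul_smul]⟩

lemma absorb {k : ℕ} {n : Fin k → ℕ} (h2 : ∀ i, 2 ≤ n i) (N : ℕ) (hN : N = ∏ i, n i)
    (X : Matrix (∀ i, Fin (n i)) (∀ i, Fin (n i)) ℂ) (hX : X.IsHermitian) (ht : X.trace = 0) :
    ∃ ε : ℝ, 0 < ε ∧ ((N : ℂ)⁻¹ • (1 : Matrix (∀ i, Fin (n i)) (∀ i, Fin (n i)) ℂ)) + ε • X ∈ MultiSep n := by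
  have hNpos : 0 < N := by
    rw [hN]; exact Finset.prod_pos fun i _ => by have := h2 i; omega
  have hNR : (0 : ℝ) < N := by exact_mod_cast hNpos
  obtain ⟨c0, hc0⟩ := PP_of_herm X hX
  set c := max c0 1
  have hc : 0 < c := lt_of_lt_of_le one_pos (le_max_right _ _)
  have hm := hc0 c (le_max_left _ _)
  have htr : ((c : ℂ) • (1 : Matrix (∀ i, Fin (n i)) (∀ i, Fin (n i)) ℂ) + X).trace = ((c * N : ℝ) : ℂ) := by
    rw [Matrix.trace_add, ht, Matrix.trace_smul, Matrix.trace_one, hN]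
    simp
  rcases Kc_mem hm with h0 | ⟨t, ht0, s, hs, he⟩
  · rw [h0] at htr
    simp at htr
    rcases htr with h | h
    · exact absurd h hc.ne'
    · omega
  · have : t = c * N := by
      rw [he, Matrix.trace_smul, (multiSep_herm hs).2] at htr
      have : (t : ℂ) = ((c * N : ℝ) : ℂ) := by rw [← htr]; simp
      exact_mod_cast this
    refine ⟨(c * N)⁻¹, by positivity, ?_⟩
    convert hs using 1
    have : s = t⁻¹ • ((c : ℂ) • (1 : Matrix (∀ i, Fin (n i)) (∀ i, Fin (n i)) ℂ) + X) := by
      rw [he, smul_smul, inv_mul_cancel₀ ht0.ne', one_smul]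
    rw [this, smul_add, ‹t = c * N›]
    congr 1
    rw [← Complex.coe_smul, smul_smul]
    congr 1
    have : (c : ℂ) ≠ 0 := by exact_mod_cast hc.ne'
    push_cast
    field_simp

/-- Traceless Hermitian matrices. -/
def TH (ι : Type) [Fintype ι] : Submodule ℝ (Matrix ι ι ℂ) where
  carrier := {X | X.IsHermitian ∧ X.trace = 0}
  add_mem' hX hY := ⟨hX.1.add hY.1, by rw [Matrix.trace_add, hX.2, hY.2, add_zero]⟩
  zero_mem' := ⟨Matrix.isHermitian_zero, Matrix.trace_zero _ _⟩
  smul_mem' a _ hX := ⟨hX.1.smul (IsSelfAdjoint.all a), by rw [Matrix.trace_smul, hX.2, smul_zero]⟩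

lemma finrank_selfAdjoint (ι : Type) [Fintype ι] [DecidableEq ι] :
    Module.finrank ℝ (selfAdjoint.submodule ℝ (Matrix ι ι ℂ)) = Fintype.card ι ^ 2 := by
  let M := Matrix ι ι ℂ
  have e1 : M ≃ₗ[ℝ] selfAdjoint M × skewAdjoint M := StarModule.decomposeProdAdjoint ℝ M
  have e2 : selfAdjoint M ≃ₗ[ℝ] skewAdjoint M := 
    { toFun := fun x => ⟨Complex.I • (x : M), by
        have := x.2
        rw [selfAdjoint.mem_iff] at this
        rw [skewAdjoint.mem_iff, star_smul, this]; simp⟩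
      invFun := fun x => ⟨(-Complex.I) • (x : M), by
        have := x.2
        rw [skewAdjoint.mem_iff] at this
        rw [selfAdjoint.mem_iff, star_smul, this]; simp⟩
      map_add' := fun x y => by ext1; simp
      map_smul' := fun r x => by ext1; exact smul_comm Complex.I r (x : M)
      left_inv := fun x => by ext1; simp [smul_smul]
      right_inv := fun x => by ext1; simp [smul_smul]; exact neg_neg (x : M) }
  have h1 := e1.finrank_eq
  have : Module.Finite ℝ (selfAdjoint M × skewAdjoint M) := Module.Finite.equiv e1
  have : Module.Finite ℝ (selfAdjoint M) := 
    Module.Finite.of_surjective (LinearMap.fst ℝ (selfAdjoint M) (skewAdjoint M)) LinearMap.fst_surjective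
  have : Module.Finite ℝ (skewAdjoint M) := Module.Finite.equiv e2
  rw [Module.finrank_prod, ← e2.finrank_eq] at h1
  have h3 : Module.finrank ℝ M = 2 * Fintype.card ι ^ 2 := by
    rw [Module.finrank_matrix, Complex.finrank_real_complex]; ring
  have h4 : Module.finrank ℝ (selfAdjoint.submodule ℝ M) = Module.finrank ℝ (selfAdjoint M) := rfl
  change Module.finrank ℝ (selfAdjoint.submodule ℝ M) = _
  omega

lemma finrank_TH (ι : Type) [Fintype ι] [DecidableEq ι] [Nonempty ι] :
    Module.finrank ℝ (TH ι) = Fintype.card ι ^ 2 - 1 := by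
  let H := selfAdjoint.submodule ℝ (Matrix ι ι ℂ)
  let φ : H →ₗ[ℝ] ℝ := Complex.reLm ∘ₗ (Matrix.traceLinearMap ι ℝ ℂ) ∘ₗ H.subtype
  have hφ : Function.Surjective φ := by
    refine LinearMap.surjective fun h => ?_
    have := congrArg (fun f => f ⟨1, Matrix.isHermitian_one⟩) h
    simp [φ] at this
  have hk : TH ι = (LinearMap.ker φ).map H.subtype := by
    ext X
    constructor
    · rintro ⟨h, ht⟩
      exact ⟨⟨X, h⟩, by simp [φ, ht], rfl⟩
    · rintro ⟨⟨Y, hY⟩, h, rfl⟩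
      have hY' : Y.IsHermitian := hY
      refine ⟨hY, ?_⟩
      simp only [φ, SetLike.mem_coe, LinearMap.mem_ker] at h
      apply Complex.ext
      · exact h
      · have : star Y.trace = Y.trace := by rw [← Matrix.trace_conjTranspose, hY'.eq]
        exact Complex.conj_eq_iff_im.1 this
  have h1 := φ.finrank_range_add_finrank_ker
  rw [LinearMap.range_eq_top.2 hφ, finrank_top, Module.finrank_self, finrank_selfAdjoint] at h1
  rw [hk, (Submodule.equivMapOfInjective _ H.subtype_injective _).symm.finrank_eq]
  omega

theorem multipartite_sep_intrinsicInterior_and_dim (k : ℕ) (hk : 1 ≤ k) (n : Fin k → ℕ)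
    (h2 : ∀ i, 2 ≤ n i) (N : ℕ) (hN : N = ∏ i, n i) :
    ((N : ℂ)⁻¹ • (1 : Matrix (∀ i, Fin (n i)) (∀ i, Fin (n i)) ℂ))
        ∈ intrinsicInterior ℝ (MultiSep n) ∧
      Module.finrank ℝ (affineSpan ℝ (MultiSep n)).direction = N ^ 2 - 1 := by
  set p := ((N : ℂ)⁻¹ • (1 : Matrix (∀ i, Fin (n i)) (∀ i, Fin (n i)) ℂ)) with hp
  have hpS : p ∈ MultiSep n := by
    obtain ⟨ε, _, h⟩ := absorb h2 N hN 0 Matrix.isHermitian_zero (Matrix.trace_zero _ _)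
    simpa using h
  have hdir : (affineSpan ℝ (MultiSep n)).direction = TH (∀ i, Fin (n i)) := by
    rw [direction_affineSpan]
    apply le_antisymm
    · rw [vectorSpan_def, Submodule.span_le]
      rintro _ ⟨X, hX, Y, hY, rfl⟩
      have hX := multiSep_herm hX
      have hY := multiSep_herm hY
      exact ⟨hX.1.sub hY.1, by
        change (X - Y).trace = 0
        rw [Matrix.trace_sub, hX.2, hY.2, sub_self]⟩
    · rintro X ⟨hX, ht⟩
      obtain ⟨ε, he, h⟩ := absorb h2 N hN X hX ht
      have := vsub_mem_vectorSpan ℝ h hpS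
      rw [vsub_eq_sub, hp, add_sub_cancel_left] at this
      exact ((vectorSpan ℝ (MultiSep n)).smul_mem_iff he.ne').1 this
  constructor
  · let S' : Set (TH (∀ i, Fin (n i))) := {v | p + (v : Matrix (∀ i, Fin (n i)) (∀ i, Fin (n i)) ℂ) ∈ MultiSep n}
    have hc : Convex ℝ S' := by
      have := ((convex_convexHull ℝ (prodStates n)).translate_preimage_right p).linear_preimage
        (TH (∀ i, Fin (n i))).subtype
      exact this
    have h0 : (0 : TH (∀ i, Fin (n i))) ∈ interior S' := by
      apply zero_mem_interior_of_absorb S' hc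
      rintro ⟨X, hX, ht⟩
      exact absorb h2 N hN X hX ht
    have hpA := subset_affineSpan ℝ _ hpS
    let g : affineSpan ℝ (MultiSep n) → TH (∀ i, Fin (n i)) := fun y =>
      ⟨(y : Matrix (∀ i, Fin (n i)) (∀ i, Fin (n i)) ℂ) - p, by
        rw [← hdir]; exact AffineSubspace.vsub_mem_direction y.2 hpA⟩
    have hg : Continuous g := by
      apply Continuous.subtype_mk
      exact continuous_subtype_val.sub continuous_const
    rw [mem_intrinsicInterior]
    refine ⟨⟨p, hpA⟩, ?_, rfl⟩
    rw [mem_interior]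
    refine ⟨g ⁻¹' interior S', ?_, isOpen_interior.preimage hg, ?_⟩
    · intro y hy
      have : g y ∈ S' := interior_subset hy
      simpa [S', g] using this
    · have : g ⟨p, hpA⟩ = 0 := by ext1; simp [g]
      rw [Set.mem_preimage, this]
      exact h0
  · rw [hdir]
    have : Nonempty (∀ i, Fin (n i)) := ⟨fun i => ⟨0, by have := h2 i; omega⟩⟩
    rw [finrank_TH, hN]
    simp
end

section
/- Let k ≥ 1, n₁,…,n_k ≥ 2, N = ∏_{i=1}^k n_i, and let S = conv(⊗_{i=1}^k P_{n_i}) be the set of multipartite separable states in H_N. Let 𝓛 be the set of all ℝ-linear maps L : H_N → H_N satisfying L(S) ⊆ S. Then 𝓛 is a convex compact subset of the space of ℝ-linear endomorphisms of H_N, and the dimension of 𝓛 as a convex set (the dimension of its affine span) equals N⁴ − N². -/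
open Matrix

/-- The standard topology on the space of `ℝ`-linear endomorphisms of `H_N` (as a
finite-dimensional real vector space): the topology induced by pointwise convergence. -/
noncomputable instance instTopEndHerm {k : ℕ} (n : Fin k → ℕ) :
    TopologicalSpace
      (selfAdjoint (Matrix (∀ i, Fin (n i)) (∀ i, Fin (n i)) ℂ) →ₗ[ℝ]
        selfAdjoint (Matrix (∀ i, Fin (n i)) (∀ i, Fin (n i)) ℂ)) :=
  TopologicalSpace.induced (fun L => ⇑L) inferInstance

theorem aux_isCompact_convexHull {V : Type*} [AddCommGroup V] [Module ℝ V] [TopologicalSpace V]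
    [IsTopologicalAddGroup V] [ContinuousSMul ℝ V] [FiniteDimensional ℝ V] {s : Set V}
    (hs : IsCompact s) : IsCompact (convexHull ℝ s) := by
  have key : convexHull ℝ s = ⋃ d ∈ Finset.range (Module.finrank ℝ V + 2),
      (fun p : (Fin d → ℝ) × (Fin d → V) => ∑ i, p.1 i • p.2 i) ''
        (stdSimplex ℝ (Fin d) ×ˢ Set.univ.pi fun _ => s) := by
    apply Set.Subset.antisymm
    · intro x hx
      obtain ⟨ι, _, z, w, hz, hi, hw, hw1, hx⟩ := eq_pos_convex_span_of_mem_convexHull hx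
      have hcard : Fintype.card ι ≤ Module.finrank ℝ V + 1 :=
        hi.card_le_finrank_succ.trans (by gcongr; exact Submodule.finrank_le _)
      simp only [Set.mem_iUnion, Finset.mem_range]
      refine ⟨Fintype.card ι, by omega, ⟨w ∘ (Fintype.equivFin ι).symm,
        z ∘ (Fintype.equivFin ι).symm⟩, ⟨⟨fun i => (hw _).le, ?_⟩, ?_⟩, ?_⟩
      · simpa using ((Fintype.equivFin ι).symm.sum_comp w).trans hw1
      · intro i _
        exact hz ⟨_, rfl⟩
      · rw [← hx]
        exact (Fintype.equivFin ι).symm.sum_comp (fun i => w i • z i)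
    · simp only [Set.iUnion_subset_iff]
      rintro d - _ ⟨⟨w, z⟩, ⟨⟨hw0, hw1⟩, hz⟩, rfl⟩
      exact (convex_convexHull ℝ s).sum_mem (fun i _ => hw0 i) hw1
        (fun i _ => subset_convexHull ℝ s (hz i trivial))
  rw [key]
  refine Finset.isCompact_biUnion _ fun d _ => ?_
  exact ((isCompact_stdSimplex ℝ (Fin d)).prod (isCompact_univ_pi fun _ => hs)).image
    (by fun_prop)

section Abstract

variable {V : Type*} [AddCommGroup V] [Module ℝ V] [TopologicalSpace V]
    [IsTopologicalAddGroup V] [ContinuousSMul ℝ V] [T2Space V] [FiniteDimensional ℝ V]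
    {S : Set V}

theorem aux_convex (hc : Convex ℝ S) : Convex ℝ {L : V →ₗ[ℝ] V | ∀ A ∈ S, L A ∈ S} := by
  intro L hL M hM a b ha hb hab A hA
  exact hc (hL A hA) (hM A hA) ha hb hab

theorem aux_compact (hS : IsCompact S) (hspan : Submodule.span ℝ S = ⊤) :
    @IsCompact (V →ₗ[ℝ] V) (TopologicalSpace.induced (fun L => ⇑L) inferInstance)
    {L : V →ₗ[ℝ] V | ∀ A ∈ S, L A ∈ S} := by
  letI : TopologicalSpace (V →ₗ[ℝ] V) := TopologicalSpace.induced (fun L => ⇑L) inferInstance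
  have hind : Topology.IsInducing (fun L : V →ₗ[ℝ] V => (L : V → V)) := ⟨rfl⟩
  rw [hind.isCompact_iff]
  have hK : ∀ v : V, ∃ K : Set V, IsCompact K ∧
      ∀ L : V →ₗ[ℝ] V, (∀ A ∈ S, L A ∈ S) → L v ∈ K := by
    intro v
    have hv : v ∈ Submodule.span ℝ S := hspan ▸ Submodule.mem_top
    induction hv using Submodule.span_induction with
    | mem x hx => exact ⟨S, hS, fun L hL => hL x hx⟩
    | zero => exact ⟨{0}, isCompact_singleton, fun L _ => by simp⟩
    | add x y _ _ hx hy =>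
      obtain ⟨K1, h1, h1'⟩ := hx
      obtain ⟨K2, h2, h2'⟩ := hy
      refine ⟨_, (h1.prod h2).image continuous_add, fun L hL => ⟨(L x, L y), ⟨h1' L hL, h2' L hL⟩, ?_⟩⟩
      simp
    | smul a x _ hx =>
      obtain ⟨K1, h1, h1'⟩ := hx
      refine ⟨_, h1.image (continuous_const_smul a), fun L hL => ⟨L x, h1' L hL, ?_⟩⟩
      simp
  choose K hK1 hK2 using hK
  refine (isCompact_univ_pi hK1).of_isClosed_subset ?_ ?_
  · have : ((fun L : V →ₗ[ℝ] V => (L : V → V)) '' {L : V →ₗ[ℝ] V | ∀ A ∈ S, L A ∈ S}) =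
        {f : V → V | (∀ x y, f (x + y) = f x + f y) ∧ (∀ (c : ℝ) x, f (c • x) = c • f x) ∧
          ∀ A ∈ S, f A ∈ S} := by
      ext f
      constructor
      · rintro ⟨L, hL, rfl⟩
        exact ⟨L.map_add, L.map_smul, hL⟩
      · rintro ⟨h1, h2, h3⟩
        exact ⟨⟨⟨f, h1⟩, h2⟩, h3, rfl⟩
    rw [this]
    simp only [Set.setOf_and, Set.setOf_forall]
    refine IsClosed.inter ?_ (IsClosed.inter ?_ ?_)
    · exact isClosed_iInter fun x => isClosed_iInter fun y =>
        isClosed_eq (by fun_prop) (by fun_prop)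
    · exact isClosed_iInter fun x => isClosed_iInter fun y =>
        isClosed_eq (by fun_prop) (by fun_prop)
    · exact isClosed_iInter fun x => isClosed_iInter fun _ =>
        hS.isClosed.preimage (continuous_apply x)
  · rintro _ ⟨L, hL, rfl⟩ v _
    exact hK2 v L hL

theorem aux_direction (hS : IsCompact S) (hspan : Submodule.span ℝ S = ⊤)
    (hc : Convex ℝ S) (hne : S.Nonempty) (tr : V →ₗ[ℝ] ℝ)
    (htr : ∀ A ∈ S, tr A = 1) :
    (affineSpan ℝ {L : V →ₗ[ℝ] V | ∀ A ∈ S, L A ∈ S}).direction =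
      LinearMap.ker (LinearMap.compRight ℝ tr : (V →ₗ[ℝ] V) →ₗ[ℝ] (V →ₗ[ℝ] ℝ)) := by
  set LL := {L : V →ₗ[ℝ] V | ∀ A ∈ S, L A ∈ S} with hLL
  rw [direction_affineSpan]
  obtain ⟨t, ht⟩ := hne
  apply le_antisymm
  · rw [vectorSpan_def, Submodule.span_le]
    rintro _ ⟨L, hL, M, hM, rfl⟩
    simp only [SetLike.mem_coe, LinearMap.mem_ker]
    apply LinearMap.ext_on hspan
    intro A hA
    simp [htr _ (hL A hA), htr _ (hM A hA)]
  · -- rank one maps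
    have base : ∀ f : V →ₗ[ℝ] ℝ, (∀ A ∈ S, 0 ≤ f A ∧ f A ≤ 1) → ∀ s ∈ S,
        f.smulRight (s - t) ∈ vectorSpan ℝ LL := by
      intro f hf s hs
      have h1 : f.smulRight s + (tr - f).smulRight t ∈ LL := by
        intro A hA
        have := hf A hA
        simpa [htr A hA] using hc hs ht this.1 (sub_nonneg.2 this.2) (by ring)
      have h2 : tr.smulRight t ∈ LL := by
        intro A hA
        simpa [htr A hA] using ht
      have := vsub_mem_vectorSpan ℝ h1 h2
      convert this using 1
      ext A
      simp [smul_sub, sub_smul]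
      abel
    have r1 : ∀ f : V →ₗ[ℝ] ℝ, ∀ s ∈ S, f.smulRight (s - t) ∈ vectorSpan ℝ LL := by
      intro f s hs
      obtain ⟨M, hM⟩ := hS.exists_bound_of_continuousOn
        (f := f) (LinearMap.continuous_of_finiteDimensional f).continuousOn
      set M' := |M| + 1 with hM'
      have hpos : 0 < M' := by positivity
      have hb := base ((2 * M')⁻¹ • (f + M' • tr)) (by
        intro A hA
        have h := hM A hA
        rw [Real.norm_eq_abs, abs_le] at h
        have h3 := le_abs_self M
        simp only [LinearMap.smul_apply, LinearMap.add_apply, htr A hA, smul_eq_mul, mul_one]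
        constructor
        · apply mul_nonneg (by positivity); linarith
        · rw [inv_mul_le_iff₀ (by positivity)]; linarith) s hs
      have ht' := base tr (fun A hA => by simp [htr A hA]) s hs
      have := Submodule.sub_mem _ (Submodule.smul_mem _ (2 * M') hb) (Submodule.smul_mem _ M' ht')
      convert this using 1
      ext A
      simp only [LinearMap.smulRight_apply, LinearMap.sub_apply, LinearMap.smul_apply,
        LinearMap.add_apply, smul_eq_mul, smul_smul]
      rw [← sub_smul]
      congr 1
      field_simp
      ring
    have r2 : ∀ f : V →ₗ[ℝ] ℝ, ∀ v : V, f.smulRight (v - tr v • t) ∈ vectorSpan ℝ LL := by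
      intro f v
      have hv : v ∈ Submodule.span ℝ S := hspan ▸ Submodule.mem_top
      induction hv using Submodule.span_induction with
      | mem x hx => simpa [htr x hx] using r1 f x hx
      | zero => 
        convert Submodule.zero_mem _ using 1
        ext; simp
      | add x y _ _ hx hy =>
        convert Submodule.add_mem _ hx hy using 1
        ext A
        simp only [LinearMap.smulRight_apply, LinearMap.add_apply, map_add]
        module
      | smul a x _ hx =>
        convert Submodule.smul_mem _ a hx using 1
        ext A
        simp only [LinearMap.smulRight_apply, LinearMap.smul_apply, map_smul, smul_eq_mul]
        module
    intro L hL
    have hL' : ∀ v, tr (L v) = 0 := fun v => by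
      simpa using LinearMap.congr_fun (LinearMap.mem_ker.1 hL) v
    let b := Module.finBasis ℝ V
    have : L = ∑ i, (b.coord i).smulRight (L (b i) - tr (L (b i)) • t) := by
      ext A
      conv_lhs => rw [← b.sum_repr A, map_sum]
      simp [hL', -Module.Basis.sum_repr]
    rw [this]
    exact Submodule.sum_mem _ fun i _ => r2 _ _

theorem aux_finrank (hS : IsCompact S) (hspan : Submodule.span ℝ S = ⊤)
    (hc : Convex ℝ S) (hne : S.Nonempty) (tr : V →ₗ[ℝ] ℝ)
    (htr : ∀ A ∈ S, tr A = 1) :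
    Module.finrank ℝ (affineSpan ℝ {L : V →ₗ[ℝ] V | ∀ A ∈ S, L A ∈ S}).direction =
      Module.finrank ℝ V * Module.finrank ℝ V - Module.finrank ℝ V := by
  rw [aux_direction hS hspan hc hne tr htr]
  obtain ⟨t, ht⟩ := hne
  have hsurj : Function.Surjective
      (LinearMap.compRight ℝ tr : (V →ₗ[ℝ] V) →ₗ[ℝ] (V →ₗ[ℝ] ℝ)) := by
    intro f
    refine ⟨f.smulRight t, ?_⟩
    ext A
    simp [htr t ht]
  have h := LinearMap.finrank_range_add_finrank_ker
    (LinearMap.compRight ℝ tr : (V →ₗ[ℝ] V) →ₗ[ℝ] (V →ₗ[ℝ] ℝ))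
  rw [LinearMap.range_eq_top.2 hsurj, finrank_top, Module.finrank_linearMap,
    Module.finrank_linearMap, Module.finrank_self] at h
  omega

end Abstract

theorem aux_sq_of_pure {m : ℕ} {A : Matrix (Fin m) (Fin m) ℂ} (h : IsPureState A) :
    A * A = A := by
  obtain ⟨hA, hr, ht⟩ := h
  rw [Matrix.rank] at hr
  obtain ⟨⟨u, hu⟩, -, hv⟩ := finrank_eq_one_iff'.1 hr
  have : ∀ j, ∃ c : ℂ, ∀ i, A i j = c * u i := by
    intro j
    obtain ⟨c, hc⟩ := hv ⟨A *ᵥ Pi.single j 1, ⟨_, rfl⟩⟩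
    refine ⟨c, fun i => ?_⟩
    have := congr_fun (congr_arg Subtype.val hc) i
    simpa using this.symm
  choose c hc using this
  have hsum : ∑ i, c i * u i = 1 := by
    rw [← ht, Matrix.trace]
    simp [hc]
  ext i j
  rw [Matrix.mul_apply]
  simp only [hc]
  rw [Finset.sum_congr rfl fun l _ => show c l * u i * (c j * u l) = (c j * u i) * (c l * u l) by ring,
    ← Finset.mul_sum, hsum, mul_one]

theorem aux_pure_of_sq {m : ℕ} {A : Matrix (Fin m) (Fin m) ℂ} (h : A.IsHermitian)
    (h2 : A * A = A) (ht : A.trace = 1) : IsPureState A := by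
  refine ⟨h, ?_, ht⟩
  have hi : IsIdempotentElem (Matrix.toLin' A) := by
    rw [IsIdempotentElem, Module.End.mul_eq_comp, ← Matrix.toLin'_mul, h2]
  have := (LinearMap.IsIdempotentElem.isProj_range _ hi).trace
  rw [Matrix.trace_toLin'_eq, ht] at this
  rw [Matrix.rank]
  exact_mod_cast this.symm

theorem aux_pure_iff {m : ℕ} {A : Matrix (Fin m) (Fin m) ℂ} :
    IsPureState A ↔ A.IsHermitian ∧ A * A = A ∧ A.trace = 1 :=
  ⟨fun h => ⟨h.1, aux_sq_of_pure h, h.2.2⟩, fun h => aux_pure_of_sq h.1 h.2.1 h.2.2⟩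

theorem aux_pure_entry {m : ℕ} {A : Matrix (Fin m) (Fin m) ℂ} (h : IsPureState A) (x y : Fin m) :
    ‖A x y‖ ≤ 1 := by
  have h1 := aux_sq_of_pure h
  have ht := h.2.2
  rw [← h1, Matrix.trace] at ht
  have h3 : ∀ i j, A i j * A j i = ((‖A i j‖ ^ 2 : ℝ) : ℂ) := by
    intro i j
    rw [← h.1.apply j i]
    simpa using Complex.mul_conj' (A i j)
  simp only [Matrix.diag_apply, Matrix.mul_apply, h3] at ht
  have ht' : ∑ i, ∑ j, ‖A i j‖ ^ 2 = 1 := by exact_mod_cast ht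
  have h4 : ‖A x y‖ ^ 2 ≤ ∑ j, ‖A x j‖ ^ 2 :=
    Finset.single_le_sum (f := fun j => ‖A x j‖ ^ 2) (fun _ _ => by positivity) (Finset.mem_univ y)
  have h5 : ∑ j, ‖A x j‖ ^ 2 ≤ ∑ i, ∑ j, ‖A i j‖ ^ 2 :=
    Finset.single_le_sum (f := fun i => ∑ j, ‖A i j‖ ^ 2) (fun _ _ => by positivity)
      (Finset.mem_univ x)
  have h6 : ‖A x y‖ ^ 2 ≤ 1 := by linarith
  exact (sq_le_one_iff₀ (norm_nonneg _)).1 h6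

theorem aux_pure_compact (m : ℕ) :
    IsCompact {A : Matrix (Fin m) (Fin m) ℂ | IsPureState A} := by
  refine (isCompact_univ_pi (X := fun _ : Fin m => Fin m → ℂ) fun _ =>
    isCompact_univ_pi fun _ => isCompact_closedBall (0 : ℂ) 1).of_isClosed_subset ?_ ?_
  · simp only [aux_pure_iff, Set.setOf_and, Matrix.IsHermitian]
    refine IsClosed.inter ?_ (IsClosed.inter ?_ ?_)
    · exact isClosed_eq (continuous_id.matrix_conjTranspose) continuous_id
    · exact isClosed_eq (continuous_id.matrix_mul continuous_id) continuous_id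
    · exact isClosed_eq (continuous_id.matrix_trace) continuous_const
  · intro A hA i _ j _
    simpa using aux_pure_entry hA i j

section Conc

variable {k : ℕ} (n : Fin k → ℕ)

theorem aux_PT_compact : IsCompact (PureTensor n) := by
  have h1 : IsCompact ((fun Q : ∀ i, Matrix (Fin (n i)) (Fin (n i)) ℂ => tensorPi Q) ''
      (Set.univ.pi fun i => {A | IsPureState A})) := by
    refine (isCompact_univ_pi fun i => aux_pure_compact (n i)).image ?_
    refine continuous_matrix fun x y => ?_
    simp only [tensorPi, Matrix.of_apply]
    refine continuous_finset_prod _ fun i _ => ?_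
    exact (continuous_apply i).matrix_elem _ _
  have hcl : IsClosed ((selfAdjoint (Matrix (∀ i, Fin (n i)) (∀ i, Fin (n i)) ℂ) :
      Set (Matrix (∀ i, Fin (n i)) (∀ i, Fin (n i)) ℂ))) := by
    have : ((selfAdjoint (Matrix (∀ i, Fin (n i)) (∀ i, Fin (n i)) ℂ) :
      Set (Matrix (∀ i, Fin (n i)) (∀ i, Fin (n i)) ℂ))) = {A | Aᴴ = A} := rfl
    rw [this]
    exact isClosed_eq (continuous_id.matrix_conjTranspose) continuous_id
  have h2 := hcl.isClosedEmbedding_subtypeVal.isCompact_preimage h1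
  have he : PureTensor n = Subtype.val ⁻¹' ((fun Q : ∀ i, Matrix (Fin (n i)) (Fin (n i)) ℂ => tensorPi Q) ''
      (Set.univ.pi fun i => {A | IsPureState A})) := ?_
  · rw [he]
    exact h2
  ext C
  simp only [PureTensor, Set.mem_setOf_eq, Set.mem_preimage, Set.mem_image, Set.mem_pi, Set.mem_univ,
    true_imp_iff]
  exact ⟨fun ⟨Q, h, e⟩ => ⟨Q, h, e.symm⟩, fun ⟨Q, h, e⟩ => ⟨Q, h, e.symm⟩⟩

/-- Trace as a real functional on Hermitian matrices. -/
noncomputable def auxTr (ι : Type*) [Fintype ι] : selfAdjoint (Matrix ι ι ℂ) →ₗ[ℝ] ℝ where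
  toFun A := (Matrix.trace (A : Matrix ι ι ℂ)).re
  map_add' A B := by simp
  map_smul' c A := by simp

theorem aux_trace_tensor (Q : ∀ i, Matrix (Fin (n i)) (Fin (n i)) ℂ) :
    (tensorPi Q).trace = ∏ i, (Q i).trace := by
  simp only [Matrix.trace, Matrix.diag_apply, tensorPi, Matrix.of_apply]
  rw [Finset.prod_univ_sum, Fintype.piFinset_univ]

theorem aux_tr_one : ∀ A ∈ convexHull ℝ (PureTensor n), auxTr _ A = 1 := by
  intro A hA
  have : convexHull ℝ (PureTensor n) ⊆ {A | auxTr _ A = 1} := by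
    refine convexHull_min ?_ ?_
    · rintro C ⟨Q, hQ, hC⟩
      simp [auxTr, hC, aux_trace_tensor, fun i => (hQ i).2.2]
    · exact (convex_singleton (1 : ℝ)).linear_preimage (auxTr _)
  exact this hA

theorem aux_single_decomp {m : ℕ} (a b : Fin m) : ∃ (c : Fin 4 → ℂ)
    (Q : Fin 4 → Matrix (Fin m) (Fin m) ℂ), (∀ j, IsPureState (Q j)) ∧
      Matrix.single a b 1 = ∑ j, c j • Q j := by
  by_cases hab : a = b
  · subst hab
    refine ⟨fun _ => 1 / 4, fun _ => Matrix.single a a 1, fun _ => aux_pure_of_sq ?_ ?_ ?_, ?_⟩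
    · simp [Matrix.IsHermitian]
    · simp
    · simp
    · simp [← Nat.cast_smul_eq_nsmul ℂ, smul_smul]
  · have hba : b ≠ a := Ne.symm hab
    have hp : ∀ w : ℂ, w * star w = 1 → IsPureState ((1 / 2 : ℂ) • (Matrix.single a a 1 +
        Matrix.single b b 1 + Matrix.single a b (star w) + Matrix.single b a w)) := by
      intro w hw
      have hw' : star w * w = 1 := by rw [mul_comm]; exact hw
      apply aux_pure_of_sq
      · simp only [Matrix.IsHermitian, Matrix.conjTranspose_smul, Matrix.conjTranspose_add,
          Matrix.conjTranspose_single, star_one, star_star, star_div₀, star_ofNat]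
        congr 1
        abel
      · simp only [smul_mul_smul_comm, add_mul, mul_add, Matrix.single_mul_single_same,
          Matrix.single_mul_single_of_ne _ _ _ _ hab, Matrix.single_mul_single_of_ne _ _ _ _ hba,
          hw, hw', one_mul, mul_one, add_zero, zero_add]
        module
      · simp [Matrix.trace_add, Matrix.trace_single_eq_of_ne, hab, hba]
        norm_num
    let w : Fin 4 → ℂ := ![1, -1, Complex.I, -Complex.I]
    refine ⟨fun j => (1 / 2) * w j, fun j => _, fun j => hp (w j) ?_, ?_⟩
    · fin_cases j <;> simp [w]
    · ext x y
      simp only [Fin.sum_univ_four, w, Matrix.add_apply, Matrix.smul_apply, Matrix.single_apply]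
      simp
      split_ifs <;> ring_nf <;> simp <;> norm_num

theorem aux_nonempty (h2 : ∀ i, 2 ≤ n i) : (PureTensor n).Nonempty := by
  have hp : ∀ i, IsPureState (Matrix.single (⟨0, by have := h2 i; omega⟩ : Fin (n i)) 
      (⟨0, by have := h2 i; omega⟩ : Fin (n i)) (1 : ℂ)) := fun i => by
    apply aux_pure_of_sq <;> simp [Matrix.IsHermitian]
  refine ⟨⟨tensorPi fun i => _, ?_⟩, _, hp, rfl⟩
  ext x y
  simp only [tensorPi, Matrix.star_apply, Matrix.of_apply, star_prod]
  exact Finset.prod_congr rfl fun i _ => (hp i).1.apply _ _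

theorem aux_tensor_sa {Q : ∀ i, Matrix (Fin (n i)) (Fin (n i)) ℂ} (hp : ∀ i, IsPureState (Q i)) :
    tensorPi Q ∈ selfAdjoint (Matrix (∀ i, Fin (n i)) (∀ i, Fin (n i)) ℂ) := by
  ext x y
  simp only [tensorPi, Matrix.star_apply, Matrix.of_apply, star_prod]
  exact Finset.prod_congr rfl fun i _ => (hp i).1.apply _ _

theorem aux_cspan : Submodule.span ℂ ((fun C : selfAdjoint (Matrix (∀ i, Fin (n i)) (∀ i, Fin (n i)) ℂ)
    => (C : Matrix (∀ i, Fin (n i)) (∀ i, Fin (n i)) ℂ)) '' PureTensor n) = ⊤ := by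
  rw [eq_top_iff]
  intro A _
  rw [Matrix.matrix_eq_sum_single A]
  refine Submodule.sum_mem _ fun x _ => Submodule.sum_mem _ fun y _ => ?_
  have : Matrix.single x y (A x y) = A x y • Matrix.single x y (1 : ℂ) := by simp
  rw [this]
  refine Submodule.smul_mem _ _ ?_
  choose c Q hQ hs using fun i => aux_single_decomp (x i) (y i)
  have : Matrix.single x y (1 : ℂ) = ∑ f : Fin k → Fin 4, (∏ i, c i (f i)) •
      tensorPi (fun i => Q i (f i)) := by
    ext u v
    have h1 : Matrix.single x y (1 : ℂ) u v = ∏ i, Matrix.single (x i) (y i) (1 : ℂ) (u i) (v i) := by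
      simp only [Matrix.single_apply]
      rw [Fintype.prod_ite_zero]
      simp [funext_iff, forall_and]
    rw [h1]
    simp only [hs, Matrix.sum_apply, Matrix.smul_apply, tensorPi, Matrix.of_apply, smul_eq_mul]
    rw [Finset.prod_univ_sum, Fintype.piFinset_univ]
    simp [Finset.prod_mul_distrib]
  rw [this]
  refine Submodule.sum_mem _ fun f _ => Submodule.smul_mem _ _ (Submodule.subset_span ?_)
  exact ⟨⟨_, aux_tensor_sa n fun i => hQ i (f i)⟩, ⟨_, fun i => hQ i (f i), rfl⟩, rfl⟩

open ComplexStarModule in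
theorem aux_span : Submodule.span ℝ (PureTensor n) = ⊤ := by
  rw [eq_top_iff]
  intro A _
  have key : ∀ B ∈ Submodule.span ℂ ((fun C : selfAdjoint (Matrix (∀ i, Fin (n i)) (∀ i, Fin (n i)) ℂ)
    => (C : Matrix (∀ i, Fin (n i)) (∀ i, Fin (n i)) ℂ)) '' PureTensor n),
      ℜ B ∈ Submodule.span ℝ (PureTensor n) ∧ ℑ B ∈ Submodule.span ℝ (PureTensor n) := by
    intro B hB
    induction hB using Submodule.span_induction with
    | mem x hx =>
      obtain ⟨C, hC, rfl⟩ := hx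
      have h1 : ℜ (C : Matrix (∀ i, Fin (n i)) (∀ i, Fin (n i)) ℂ) = C := Subtype.ext (IsSelfAdjoint.coe_realPart C.2)
      have h2 : ℑ (C : Matrix (∀ i, Fin (n i)) (∀ i, Fin (n i)) ℂ) = 0 := IsSelfAdjoint.imaginaryPart C.2
      simp only [h1, h2]
      exact ⟨Submodule.subset_span hC, Submodule.zero_mem _⟩
    | zero => simp
    | add x y _ _ hx hy =>
      simp only [map_add]
      exact ⟨Submodule.add_mem _ hx.1 hy.1, Submodule.add_mem _ hx.2 hy.2⟩
    | smul a x _ hx =>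
      rw [realPart_smul, imaginaryPart_smul]
      exact ⟨Submodule.sub_mem _ (Submodule.smul_mem _ _ hx.1) (Submodule.smul_mem _ _ hx.2),
        Submodule.add_mem _ (Submodule.smul_mem _ _ (by first | exact hx.1 | exact hx.2))
          (Submodule.smul_mem _ _ (by first | exact hx.1 | exact hx.2))⟩
  have := (key A (aux_cspan n ▸ Submodule.mem_top)).1
  rwa [show ℜ (A : Matrix (∀ i, Fin (n i)) (∀ i, Fin (n i)) ℂ) = A from
    Subtype.ext (IsSelfAdjoint.coe_realPart A.2)] at this

end Conc

/-- skew-adjoint and self-adjoint matrices are isomorphic over the reals. -/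
noncomputable def auxSkew (A : Type*) [AddCommGroup A] [StarAddMonoid A] [Module ℂ A]
    [StarModule ℂ A] : skewAdjoint A ≃ₗ[ℝ] selfAdjoint A :=
  LinearEquiv.ofBijective skewAdjoint.negISMul (by
    constructor
    · intro a b h
      have := congr_arg (fun x : selfAdjoint A => Complex.I • (x : A)) h
      simp only [skewAdjoint.I_smul_neg_I] at this
      exact Subtype.ext this
    · intro a
      refine ⟨⟨Complex.I • (a : A), ?_⟩, ?_⟩
      · rw [skewAdjoint.mem_iff, star_smul, a.2.star_eq]
        simp
      · apply Subtype.ext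
        simp [skewAdjoint.negISMul, smul_smul])

instance auxFin (ι : Type*) [Fintype ι] : FiniteDimensional ℝ (selfAdjoint (Matrix ι ι ℂ)) := by
  classical
  exact Module.Finite.of_surjective (selfAdjointPart ℝ (A := Matrix ι ι ℂ)) fun a =>
    ⟨a, IsSelfAdjoint.selfAdjointPart_apply ℝ a.2⟩

theorem aux_dim (ι : Type*) [Fintype ι] :
    Module.finrank ℝ (selfAdjoint (Matrix ι ι ℂ)) = Fintype.card ι ^ 2 := by
  classical
  have e := (StarModule.decomposeProdAdjoint ℝ (Matrix ι ι ℂ)).trans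
    ((LinearEquiv.refl ℝ _).prodCongr (auxSkew (Matrix ι ι ℂ)))
  have h := e.finrank_eq
  rw [Module.finrank_prod, finrank_real_of_complex, Module.finrank_matrix] at h
  simp at h
  nlinarith

instance auxSMul (ι : Type*) [Fintype ι] : ContinuousSMul ℝ (selfAdjoint (Matrix ι ι ℂ)) :=
  ⟨Continuous.subtype_mk (continuous_fst.smul (continuous_subtype_val.comp continuous_snd)) _⟩


/-- Corollary 3.3 (first part): the set `𝓛` of all `ℝ`-linear maps `L : H_N → H_N` with
`L(S) ⊆ S` (where `S = conv(⊗_{i=1}^k P_{n_i})` are the multipartite separable states) is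
a convex compact subset of the endomorphisms of `H_N`, of dimension `N⁴ - N²`. -/
theorem sep_preserving_maps_convex_compact_dim (k : ℕ) (hk : 1 ≤ k) (n : Fin k → ℕ)
    (h2 : ∀ i, 2 ≤ n i) (N : ℕ) (hN : N = ∏ i, n i)
    (𝓛 : Set (selfAdjoint (Matrix (∀ i, Fin (n i)) (∀ i, Fin (n i)) ℂ) →ₗ[ℝ]
          selfAdjoint (Matrix (∀ i, Fin (n i)) (∀ i, Fin (n i)) ℂ)))
    (h𝓛 : 𝓛 = {L | ∀ A ∈ convexHull ℝ (PureTensor n), L A ∈ convexHull ℝ (PureTensor n)}) :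
    Convex ℝ 𝓛 ∧ IsCompact 𝓛 ∧
      Module.finrank ℝ (affineSpan ℝ 𝓛).direction = N ^ 4 - N ^ 2 := by
  subst h𝓛
  have hS := aux_isCompact_convexHull (aux_PT_compact n)
  have hsp : Submodule.span ℝ (convexHull ℝ (PureTensor n)) = ⊤ :=
    eq_top_iff.2 ((aux_span n).symm.le.trans (Submodule.span_mono (subset_convexHull ℝ _)))
  have hc := convex_convexHull ℝ (PureTensor n)
  refine ⟨aux_convex hc, aux_compact hS hsp, ?_⟩
  rw [aux_finrank hS hsp hc (aux_nonempty n h2).convexHull (auxTr _) (aux_tr_one n), aux_dim]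
  rw [Fintype.card_pi]
  simp only [Fintype.card_fin]
  rw [← hN]
  ring_nf
end

section
/- Let m, n ≥ 2 and let Ψ : M_{mn} → M_{mn} be a ℂ-linear map with adjoint Ψ* (with respect to the inner product ⟨X,Y⟩ = tr(XY*)). The following are equivalent: (a) W^⊗(Ψ*(T)) = W^⊗(T) for all T ∈ M_{mn}; (b) conv(W^⊗(Ψ*(T))) = conv(W^⊗(T)) for all T ∈ M_{mn}; (c) there exist unitary matrices U ∈ M_m and V ∈ M_n such that either Ψ(A ⊗ B) = ψ₁(A) ⊗ ψ₂(B) for all A ∈ M_m, B ∈ M_n, or m = n and Ψ(A ⊗ B) = ψ₂(B) ⊗ ψ₁(A) for all A ∈ M_m, B ∈ M_n, where ψ₁ has the form A ↦ UAU* or A ↦ UAᵀU*, and ψ₂ has the form B ↦ VBV* or B ↦ VBᵀV*. -/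
open Matrix Kronecker

/-- The product numerical range `W^⊗(T) = {tr(TX) : X ∈ P_m ⊗ P_n}` of
`T ∈ M_{mn} ≡ M_m ⊗ M_n`. -/
def prodNumRange {m n : ℕ} (T : Matrix (Fin m × Fin n) (Fin m × Fin n) ℂ) : Set ℂ :=
  {z | ∃ P Q, IsPureState P ∧ IsPureState Q ∧ z = (T * (P ⊗ₖ Q)).trace}

namespace PNR

/-- The rank one operator `x y*`. -/
def R {m : ℕ} (x y : Fin m → ℂ) : Matrix (Fin m) (Fin m) ℂ := vecMulVec x (star y)

section basic
variable {m : ℕ}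

lemma R_add_left (x y z : Fin m → ℂ) : R (x + y) z = R x z + R y z := add_vecMulVec _ _ _
lemma R_add_right (x y z : Fin m → ℂ) : R x (y + z) = R x y + R x z := by
  simp [R, vecMulVec_add]
lemma R_smul_left (c : ℂ) (x y : Fin m → ℂ) : R (c • x) y = c • R x y := smul_vecMulVec _ _ _
lemma R_smul_right (c : ℂ) (x y : Fin m → ℂ) : R x (c • y) = star c • R x y := by
  simp [R, vecMulVec_smul]
lemma R_conjTranspose (x y : Fin m → ℂ) : (R x y)ᴴ = R y x := by
  simp [R, conjTranspose_vecMulVec]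
lemma R_trace (x y : Fin m → ℂ) : (R x y).trace = star y ⬝ᵥ x := by
  simp [R, trace_vecMulVec, dotProduct_comm]
lemma R_mul (x y z w : Fin m → ℂ) : R x y * R z w = (star y ⬝ᵥ z) • R x w := by
  simp [R, vecMulVec_mul_vecMulVec, vecMulVec_smul]

lemma pure_of_unit (x : Fin m → ℂ) (hx : star x ⬝ᵥ x = 1) : IsPureState (R x x) := by
  refine ⟨R_conjTranspose x x, ?_, by rw [R_trace, hx]⟩
  apply le_antisymm (rank_vecMulVec_le _ _)
  rw [Nat.one_le_iff_ne_zero]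
  intro h
  have h0 : R x x = 0 := by
    have : (R x x).mulVecLin = 0 := by
      rw [← LinearMap.range_eq_bot, ← Submodule.finrank_eq_zero (R := ℂ)]; exact h
    ext i j
    have := congrFun (LinearMap.congr_fun this (Pi.single j 1)) i
    simpa using this
  have := R_trace x x
  rw [h0, hx] at this
  simp at this

lemma exists_unit_of_pure {P : Matrix (Fin m) (Fin m) ℂ} (hP : IsPureState P) :
    ∃ x : Fin m → ℂ, star x ⬝ᵥ x = 1 ∧ P = R x x := by
  obtain ⟨hH, hr, ht⟩ := hP
  obtain ⟨⟨v, hv⟩, hv0, hall⟩ := (finrank_eq_one_iff' (K := ℂ)).1 hr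
  have h1 : ∀ j, ∃ c : ℂ, c • v = P *ᵥ (Pi.single j 1) := by
    intro j
    obtain ⟨c, hc⟩ := hall ⟨P *ᵥ (Pi.single j 1), ⟨_, rfl⟩⟩
    exact ⟨c, congrArg Subtype.val hc⟩
  choose c hc using h1
  have hPv : ∀ a b, P a b = c b * v a := by
    intro a b
    have := congrFun (hc b) a
    simpa using this.symm
  have htr : ∑ a, c a * v a = 1 := by
    rw [← ht]; simp [trace, hPv]
  have hherm : ∀ a b, c b * v a = star (c a) * star (v b) := by
    intro a b
    have := congrFun (congrFun hH a) b
    rw [conjTranspose_apply, hPv, hPv] at this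
    rw [← this]; simp [mul_comm]
  set s : ℝ := ∑ a, ‖c a‖ ^ 2 with hs
  have hs0 : 0 ≤ s := by positivity
  have hcs : ∀ b, c b = s * star (v b) := by
    intro b
    calc c b = c b * ∑ a, c a * v a := by rw [htr, mul_one]
      _ = ∑ a, c a * (c b * v a) := by rw [Finset.mul_sum]; congr 1; ext; ring
      _ = ∑ a, (c a * star (c a)) * star (v b) := by
          congr 1; ext a; rw [hherm]; ring
      _ = s * star (v b) := by
          rw [← Finset.sum_mul, hs]; congr 1; push_cast
          congr 1; ext a
          exact Complex.mul_conj' (c a)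
  have hsq : ((Real.sqrt s : ℝ) : ℂ) * (Real.sqrt s : ℝ) = s := by
    rw [← Complex.ofReal_mul, Real.mul_self_sqrt hs0]
  have hPR : P = R (((Real.sqrt s : ℝ) : ℂ) • v) (((Real.sqrt s : ℝ) : ℂ) • v) := by
    ext a b
    rw [R_smul_left, R_smul_right, hPv, hcs]
    simp only [Matrix.smul_apply, R, vecMulVec_apply, Pi.star_apply, smul_eq_mul]
    rw [← hsq]; simp; ring
  refine ⟨_, ?_, hPR⟩
  rw [← R_trace, ← hPR, ht]

lemma star_dot_self (x : Fin m → ℂ) : star x ⬝ᵥ x = ((∑ i, ‖x i‖ ^ 2 : ℝ) : ℂ) := by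
  simp only [dotProduct, Pi.star_apply]
  push_cast
  congr 1; ext i
  exact Complex.conj_mul' (x i)

lemma exists_normalize (x : Fin m → ℂ) (hx : x ≠ 0) :
    ∃ (r : ℝ) (y : Fin m → ℂ), 0 < r ∧ star y ⬝ᵥ y = 1 ∧ x = (r : ℂ) • y ∧
      star x ⬝ᵥ x = ((r ^ 2 : ℝ) : ℂ) := by
  set s : ℝ := ∑ i, ‖x i‖ ^ 2 with hs
  have hs0 : 0 < s := by
    obtain ⟨i, hi⟩ := Function.ne_iff.1 hx
    have : 0 < ‖x i‖ ^ 2 := by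
      have : 0 < ‖x i‖ := norm_pos_iff.2 hi
      positivity
    exact this.trans_le (Finset.single_le_sum (f := fun i => ‖x i‖ ^ 2)
      (fun j _ => by positivity) (Finset.mem_univ i))
  have hr : 0 < Real.sqrt s := Real.sqrt_pos.2 hs0
  have hr' : ((Real.sqrt s : ℝ) : ℂ) ≠ 0 := by exact_mod_cast hr.ne'
  refine ⟨Real.sqrt s, ((Real.sqrt s : ℝ) : ℂ)⁻¹ • x, hr, ?_, ?_, ?_⟩
  · rw [star_smul, smul_dotProduct, dotProduct_smul, star_dot_self, ← hs]
    simp only [smul_eq_mul, star_inv₀, RCLike.star_def, Complex.conj_ofReal]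
    field_simp
    rw [← Complex.ofReal_pow, Real.sq_sqrt hs0.le]
  · rw [smul_smul, mul_inv_cancel₀ hr', one_smul]
  · rw [star_dot_self, Real.sq_sqrt hs0.le]

lemma pure_idem {P : Matrix (Fin m) (Fin m) ℂ} (hP : IsPureState P) : P * P = P := by
  obtain ⟨x, hx, rfl⟩ := exists_unit_of_pure hP
  rw [R_mul, hx, one_smul]

end basic

section polar
variable {E : Type*} [AddCommGroup E] [Module ℂ E]

/-- extraction of the coefficient of `conj(w)^2`. -/
lemma coef_zero (e00 e10 e01 e20 e02 e11 e21 e12 e22 : E)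
    (h : ∀ w : ℂ, e00 + w • e10 + star w • e01 + (w * w) • e20 + (star w * star w) • e02 +
      (w * star w) • e11 + (w * w * star w) • e21 + (w * star w * star w) • e12 +
      (w * w * star w * star w) • e22 = 0) : e02 = 0 := by
  have hI : star Complex.I = -Complex.I := Complex.conj_I
  have hII : Complex.I * Complex.I = -1 := Complex.I_mul_I
  have h1 := h 1
  have h2 := h (-1)
  have h3 := h Complex.I
  have h4 := h (-Complex.I)
  have h5 := h (1 + Complex.I)
  have h6 := h (-1 - Complex.I)
  have h7 := h (1 - Complex.I)
  have h8 := h (-1 + Complex.I)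
  simp only [star_add, star_sub, star_neg, hI, star_one, neg_neg] at h1 h2 h3 h4 h5 h6 h7 h8
  have key : e02 + e20 = 0 := by
    have : (4 : ℂ) • (e02 + e20) = 0 := by
      have e := congrArg₂ (· - ·) (congrArg₂ (· + ·) h1 h2) (congrArg₂ (· + ·) h3 h4)
      simp only [add_zero, sub_zero] at e
      rw [← e]
      match_scalars <;> ring_nf <;> simp <;> norm_num
    exact (smul_eq_zero.1 this).resolve_left (by norm_num)
  have key2 : e20 - e02 = 0 := by
    have : (8 * Complex.I : ℂ) • (e20 - e02) = 0 := by
      have e := congrArg₂ (· - ·) (congrArg₂ (· + ·) h5 h6) (congrArg₂ (· + ·) h7 h8)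
      simp only [add_zero, sub_zero] at e
      rw [← e]
      match_scalars <;> ring_nf
    exact (smul_eq_zero.1 this).resolve_left (by simp)
  have : (2 : ℂ) • e02 = 0 := by
    have e := congrArg₂ (· - ·) key key2
    simp only [sub_zero] at e
    rw [← e]; module
  exact (smul_eq_zero.1 this).resolve_left (by norm_num)

end polar
end PNR

namespace PNR
section polar2
variable {E : Type*} [AddCommGroup E] [Module ℂ E] {m : ℕ}

lemma bil_diag (β : Matrix (Fin m) (Fin m) ℂ →ₗ[ℂ] Matrix (Fin m) (Fin m) ℂ →ₗ[ℂ] E)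
    (lam : Matrix (Fin m) (Fin m) ℂ →ₗ[ℂ] E) (h : ∀ P, IsPureState P → β P P = lam P)
    (x : Fin m → ℂ) : β (R x x) (R x x) = (star x ⬝ᵥ x) • lam (R x x) := by
  by_cases hx : x = 0
  · subst hx; simp [R]
  obtain ⟨r, y, hr, hy, hxy, hn⟩ := exists_normalize x hx
  have := h _ (pure_of_unit y hy)
  rw [hn, hxy, R_smul_left, R_smul_right]
  simp only [map_smul, LinearMap.smul_apply, this, smul_smul]
  congr 1
  rw [RCLike.star_def, Complex.conj_ofReal]; push_cast; ring

lemma bil_rank_one (β : Matrix (Fin m) (Fin m) ℂ →ₗ[ℂ] Matrix (Fin m) (Fin m) ℂ →ₗ[ℂ] E)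
    (lam : Matrix (Fin m) (Fin m) ℂ →ₗ[ℂ] E) (h : ∀ P, IsPureState P → β P P = lam P)
    (x y : Fin m → ℂ) : β (R x y) (R x y) = (star y ⬝ᵥ x) • lam (R x y) := by
  have hd := bil_diag β lam h
  rw [← sub_eq_zero]
  have key : ∀ w : ℂ, β (R (x + w • y) (x + w • y)) (R (x + w • y) (x + w • y)) -
      (star (x + w • y) ⬝ᵥ (x + w • y)) • lam (R (x + w • y) (x + w • y)) = 0 :=
    fun w => sub_eq_zero.2 (hd _)
  simp only [R_add_left, R_add_right, R_smul_left, R_smul_right, map_add, map_smul,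
    LinearMap.add_apply, LinearMap.smul_apply, star_add, star_smul, add_dotProduct,
    dotProduct_add, smul_dotProduct, dotProduct_smul, smul_eq_mul] at key
  refine coef_zero
    (β (R x x) (R x x) - (star x ⬝ᵥ x) • lam (R x x))
    (β (R x x) (R y x) + β (R y x) (R x x) - (star x ⬝ᵥ x) • lam (R y x)
      - (star x ⬝ᵥ y) • lam (R x x))
    (β (R x x) (R x y) + β (R x y) (R x x) - (star x ⬝ᵥ x) • lam (R x y)
      - (star y ⬝ᵥ x) • lam (R x x))
    (β (R y x) (R y x) - (star x ⬝ᵥ y) • lam (R y x))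
    _
    (β (R x x) (R y y) + β (R y y) (R x x) + β (R x y) (R y x) + β (R y x) (R x y)
      - (star x ⬝ᵥ x) • lam (R y y) - (star y ⬝ᵥ y) • lam (R x x)
      - (star y ⬝ᵥ x) • lam (R y x) - (star x ⬝ᵥ y) • lam (R x y))
    (β (R y y) (R y x) + β (R y x) (R y y) - (star y ⬝ᵥ y) • lam (R y x)
      - (star x ⬝ᵥ y) • lam (R y y))
    (β (R y y) (R x y) + β (R x y) (R y y) - (star y ⬝ᵥ y) • lam (R x y)
      - (star y ⬝ᵥ x) • lam (R y y))
    (β (R y y) (R y y) - (star y ⬝ᵥ y) • lam (R y y)) ?_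
  intro w
  rw [← key w]
  module

lemma bil_polar (β : Matrix (Fin m) (Fin m) ℂ →ₗ[ℂ] Matrix (Fin m) (Fin m) ℂ →ₗ[ℂ] E)
    (lam : Matrix (Fin m) (Fin m) ℂ →ₗ[ℂ] E) (h : ∀ P, IsPureState P → β P P = lam P)
    (x y z w : Fin m → ℂ) :
    β (R x y) (R z w) + β (R z w) (R x y) + (β (R x w) (R z y) + β (R z y) (R x w)) =
      (star y ⬝ᵥ x) • lam (R z w) + (star w ⬝ᵥ z) • lam (R x y) +
      ((star w ⬝ᵥ x) • lam (R z y) + (star y ⬝ᵥ z) • lam (R x w)) := by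
  have hr := bil_rank_one β lam h
  have h1 : ∀ x z y, β (R x y) (R z y) + β (R z y) (R x y) =
      (star y ⬝ᵥ x) • lam (R z y) + (star y ⬝ᵥ z) • lam (R x y) := by
    intro x z y
    have e := hr (x + z) y
    simp only [R_add_left, map_add, LinearMap.add_apply, dotProduct_add, hr] at e
    rw [← sub_eq_zero] at e ⊢
    rw [← e]
    module
  have e := h1 x z (y + w)
  have e1 := h1 x z y
  have e2 := h1 x z w
  simp only [R_add_right, map_add, LinearMap.add_apply, star_add, add_dotProduct] at e
  rw [← sub_eq_zero] at e e1 e2 ⊢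
  have := congrArg₂ (· - ·) e (congrArg₂ (· + ·) e1 e2)
  simp only [add_zero, sub_zero] at this
  rw [← this]
  module

lemma lin_ext (L : Matrix (Fin m) (Fin m) ℂ →ₗ[ℂ] E) (h : ∀ P, IsPureState P → L P = 0) :
    L = 0 := by
  have hd : ∀ x, L (R x x) = 0 := by
    intro x
    by_cases hx : x = 0
    · subst hx; simp [R]
    obtain ⟨r, y, hr, hy, hxy, hn⟩ := exists_normalize x hx
    rw [hxy, R_smul_left, R_smul_right, map_smul, map_smul, h _ (pure_of_unit y hy)]
    simp
  have h2 : ∀ x y, L (R x y) = 0 := by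
    intro x y
    have e1 := hd (x + y)
    have e2 := hd (x + Complex.I • y)
    simp only [R_add_left, R_add_right, R_smul_left, R_smul_right, map_add, map_smul, hd,
      RCLike.star_def, Complex.conj_I, smul_zero, add_zero, zero_add] at e1 e2
    have : (2 : ℂ) • L (R x y) = 0 := by
      have := congrArg₂ (· + ·) e1 (congrArg (fun t => Complex.I • t) e2)
      simp only [add_zero, smul_zero] at this
      rw [← this]
      match_scalars <;> ring_nf <;> simp <;> norm_num
    exact (smul_eq_zero.1 this).resolve_left (by norm_num)
  apply LinearMap.ext
  intro X
  rw [LinearMap.zero_apply, matrix_eq_sum_single X]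
  simp only [map_sum]
  refine Finset.sum_eq_zero fun i _ => Finset.sum_eq_zero fun j _ => ?_
  have : single i j (X i j) = (X i j) • R (Pi.single i 1) (Pi.single j 1) := by
    rw [R, ← Pi.single_star, star_one, ← single_eq_single_vecMulVec_single]
    simp
  rw [this, map_smul, h2]; simp

lemma lin_ext_eq (L L' : Matrix (Fin m) (Fin m) ℂ →ₗ[ℂ] E)
    (h : ∀ P, IsPureState P → L P = L' P) : L = L' := by
  rw [← sub_eq_zero]
  exact lin_ext _ fun P hP => by simp [h P hP]

lemma span_pure (N : Submodule ℂ (Matrix (Fin m) (Fin m) ℂ)) (h : ∀ P, IsPureState P → P ∈ N) :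
    N = ⊤ := by
  have : N.mkQ = 0 := lin_ext _ fun P hP => by simpa using h P hP
  rw [← N.ker_mkQ, this, LinearMap.ker_zero]

end polar2
end PNR

namespace PNR
section dich
variable {m : ℕ}

lemma orth_decomp (x z : Fin m → ℂ) (hx : star x ⬝ᵥ x = 1) (hz : star z ⬝ᵥ z = 1) :
    R x x = R z z ∨ ∃ (y : Fin m → ℂ) (s : ℂ) (r : ℝ), star y ⬝ᵥ y = 1 ∧ star x ⬝ᵥ y = 0 ∧
      star y ⬝ᵥ x = 0 ∧ z = s • x + (r : ℂ) • y ∧ s * star s + r * r = 1 := by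
  set s := star x ⬝ᵥ z with hs
  by_cases h0 : z - s • x = 0
  · left
    have hzs : z = s • x := sub_eq_zero.1 h0
    have h1 : R z z = (s * star s) • R x x := by
      conv_lhs => rw [hzs]
      rw [R_smul_left, R_smul_right, smul_smul]
    have h2 := congrArg trace h1
    rw [R_trace, trace_smul, R_trace, hx, hz] at h2
    rw [h1]
    simp only [smul_eq_mul, mul_one] at h2
    rw [← h2, one_smul]
  · right
    obtain ⟨r, y, hr, hy, hzy, -⟩ := exists_normalize _ h0
    have hr' : (r : ℂ) ≠ 0 := by exact_mod_cast hr.ne'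
    have hxy : star x ⬝ᵥ y = 0 := by
      have : star x ⬝ᵥ (z - s • x) = 0 := by
        rw [dotProduct_sub, dotProduct_smul, hx, ← hs]; simp
      rw [hzy, dotProduct_smul] at this
      exact (smul_eq_zero.1 this).resolve_left hr'
    have hyx : star y ⬝ᵥ x = 0 := by
      rw [star_dotProduct, hxy, star_zero]
    have hzd : z = s • x + (r : ℂ) • y := by rw [← hzy]; abel
    refine ⟨y, s, r, hy, hxy, hyx, hzd, ?_⟩
    rw [hzd] at hz
    simp only [star_add, star_smul, add_dotProduct, dotProduct_add, smul_dotProduct,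
      dotProduct_smul, hx, hy, hxy, hyx, smul_eq_mul, RCLike.star_def, Complex.conj_ofReal] at hz
    rw [← hz]; simp

lemma scalar_dich (f g l : Matrix (Fin m) (Fin m) ℂ →ₗ[ℂ] ℂ)
    (h : ∀ P, IsPureState P → f P * g P = l P) (P P' : Matrix (Fin m) (Fin m) ℂ)
    (hP : IsPureState P) (hP' : IsPureState P') : (f P - f P') * (g P - g P') = 0 := by
  obtain ⟨x, hx, rfl⟩ := exists_unit_of_pure hP
  obtain ⟨z, hz, rfl⟩ := exists_unit_of_pure hP'
  rcases orth_decomp x z hx hz with he | ⟨y, s, r, hy, hxy, hyx, hzd, hsr⟩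
  · rw [he]; simp
  let β : Matrix (Fin m) (Fin m) ℂ →ₗ[ℂ] Matrix (Fin m) (Fin m) ℂ →ₗ[ℂ] ℂ :=
    (LinearMap.mul ℂ ℂ).compl₁₂ f g
  have hβ : ∀ X Y, β X Y = f X * g Y := fun X Y => by simp [β]
  have hb : ∀ P, IsPureState P → β P P = l P := fun P hP => by rw [hβ]; exact h P hP
  have pol := bil_polar β l hb
  have r1 := bil_rank_one β l hb
  have d1 := h _ hP
  have d2 := h _ (pure_of_unit y hy)
  have c1 := r1 x y
  have c2 := r1 y x
  have c3 := pol x x x y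
  have c4 := pol x y y y
  have c5 := pol x x y x
  have c6 := pol y x y y
  have c7 := pol x x y y
  simp only [hβ, hx, hy, hxy, hyx, smul_eq_mul, zero_mul, one_mul, add_zero, zero_add]
    at c1 c2 c3 c4 c5 c6 c7
  have hfz : f (R x x) - f (R z z) = r * r * (f (R x x) - f (R y y)) - s * r * f (R x y)
      - star s * r * f (R y x) := by
    rw [hzd]
    simp only [R_add_left, R_add_right, R_smul_left, R_smul_right, map_add, map_smul,
      smul_eq_mul, RCLike.star_def, Complex.conj_ofReal]
    rw [RCLike.star_def] at hsr
    linear_combination (-f (R x x)) * hsr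
  have hgz : g (R x x) - g (R z z) = r * r * (g (R x x) - g (R y y)) - s * r * g (R x y)
      - star s * r * g (R y x) := by
    rw [hzd]
    simp only [R_add_left, R_add_right, R_smul_left, R_smul_right, map_add, map_smul,
      smul_eq_mul, RCLike.star_def, Complex.conj_ofReal]
    rw [RCLike.star_def] at hsr
    linear_combination (-g (R x x)) * hsr
  rw [hfz, hgz]
  generalize f (R x x) = a at *
  generalize g (R x x) = a' at *
  generalize f (R y y) = b at *
  generalize g (R y y) = b' at *
  generalize f (R x y) = c at *
  generalize g (R x y) = c' at *
  generalize f (R y x) = d at *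
  generalize g (R y x) = d' at *
  have e1 : (a - b) * c' + (a' - b') * c = 0 := by linear_combination (1/2) * c3 - (1/2) * c4
  have e2 : (a - b) * d' + (a' - b') * d = 0 := by linear_combination (1/2) * c5 - (1/2) * c6
  have e3 : (a - b) * (a' - b') = c * d' + d * c' := by linear_combination d1 + d2 - c7
  have sq : ∀ t : ℂ, t * t = 0 → t = 0 := fun t ht => mul_self_eq_zero.1 ht
  have z1 : (a - b) * c' = 0 := sq _ (by linear_combination ((a - b) * c') * e1 - (a-b)*(a'-b') * c1)
  have z2 : (a' - b') * c = 0 := by linear_combination e1 - z1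
  have z3 : (a - b) * d' = 0 := sq _ (by linear_combination ((a - b) * d') * e2 - (a-b)*(a'-b') * c2)
  have z4 : (a' - b') * d = 0 := by linear_combination e2 - z3
  have z5 : (a - b) * (a' - b') = 0 := sq _ (by
    linear_combination (a - b) * (a' - b') * e3 + (a-b) * d' * z2 + (a-b) * c' * z4)
  have z6 : c * d' = 0 := sq _ (by
    linear_combination c * d' * (z5 - e3) - d * d' * c1)
  have z7 : d * c' = 0 := by linear_combination z5 - e3 - z6
  linear_combination r*r*r*r * z5 - r*r*s*r * z1 - r*r*s*r*z2 - r*r*star s*r * z3 - r*r*star s*r*z4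
    + s*r*s*r*c1 + s*r*star s*r*z6 + s*r*star s*r*z7 + star s*r*star s*r*c2

lemma two_rel {α γ δ : Type*} (f : α → γ) (g : α → δ) (p : α → Prop)
    (h : ∀ a b, p a → p b → f a = f b ∨ g a = g b) :
    (∀ a b, p a → p b → f a = f b) ∨ (∀ a b, p a → p b → g a = g b) := by
  by_contra hc
  push Not at hc
  obtain ⟨⟨a, b, ha, hb, hab⟩, ⟨c, d, hc', hd, hcd⟩⟩ := hc
  have := h a b ha hb
  have := h c d hc' hd
  have := h a c ha hc'
  have := h a d ha hd
  have := h b c hb hc'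
  have := h b d hb hd
  grind

/-- matrix version of the dichotomy -/
lemma matrix_dich {m' n' : Type*} (F : Matrix (Fin m) (Fin m) ℂ →ₗ[ℂ] Matrix m' m' ℂ)
    (G : Matrix (Fin m) (Fin m) ℂ →ₗ[ℂ] Matrix n' n' ℂ)
    (L : Matrix (Fin m) (Fin m) ℂ →ₗ[ℂ] Matrix (m' × n') (m' × n') ℂ)
    (h : ∀ P, IsPureState P → F P ⊗ₖ G P = L P) :
    (∀ P P', IsPureState P → IsPureState P' → F P = F P') ∨
    (∀ P P', IsPureState P → IsPureState P' → G P = G P') := by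
  refine two_rel F G IsPureState fun P P' hP hP' => ?_
  by_contra hc
  push Not at hc
  obtain ⟨h1, h2⟩ := hc
  obtain ⟨a, b, hab⟩ : ∃ a b, F P a b ≠ F P' a b := by
    by_contra hh; push Not at hh; exact h1 (Matrix.ext hh)
  obtain ⟨c, d, hcd⟩ : ∃ a b, G P a b ≠ G P' a b := by
    by_contra hh; push Not at hh; exact h2 (Matrix.ext hh)
  have := scalar_dich ((entryLinearMap ℂ ℂ a b).comp F) ((entryLinearMap ℂ ℂ c d).comp G)
    ((entryLinearMap ℂ ℂ (a, c) (b, d)).comp L) (fun P hP => by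
      simp [← h P hP]) P P' hP hP'
  simp only [LinearMap.comp_apply, entryLinearMap_apply] at this
  rcases mul_eq_zero.1 this with h | h
  · exact hab (sub_eq_zero.1 h)
  · exact hcd (sub_eq_zero.1 h)
end dich
end PNR

namespace PNR
section wigner
variable {m : ℕ}

lemma orth_of_jordan {p q Z : Matrix (Fin m) (Fin m) ℂ} (hp : IsPureState p) (hq : IsPureState q)
    (hpq : p ≠ q) (hZ : Z ≠ 0) (hZZ : Z * Z = 0) (h1 : p * Z + Z * p = Z)
    (h2 : q * Z + Z * q = Z) : p * q = 0 ∧ (Z * p = 0 ∨ p * Z = 0) := by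
  have hpp := pure_idem hp
  have hqq := pure_idem hq
  obtain ⟨u, hu, rfl⟩ := exists_unit_of_pure hp
  obtain ⟨v, hv, rfl⟩ := exists_unit_of_pure hq
  have hZpZ : Z * R u u * Z = 0 := by
    have : Z * Z = Z * (R u u * Z + Z * R u u) := by rw [h1]
    rw [mul_add, ← mul_assoc, ← mul_assoc, hZZ, zero_mul, add_zero] at this
    exact this.symm
  have hcases : Z * R u u = 0 ∨ R u u * Z = 0 := by
    simp only [R, mul_vecMulVec, vecMulVec_mul] at hZpZ ⊢
    rcases vecMulVec_eq_zero.1 hZpZ with h | h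
    · left; rw [h]; simp
    · right; rw [h]; simp
  refine ⟨?_, hcases⟩
  set c : ℂ := (star u ⬝ᵥ v) * (star v ⬝ᵥ u) with hc
  have hpqp : R u u * R v v * R u u = c • R u u := by
    rw [R_mul, smul_mul_assoc, R_mul, smul_smul]
  have hc01 : c = 0 ∨ c = 1 := by
    have : (c * (1 - c)) • Z = 0 := by
      rcases hcases with h | h
      · have hZ1 : R u u * Z = Z := by rw [h, add_zero] at h1; exact h1
        have hZq : Z * R v v = (1 - c) • Z := by
          have := congrArg (fun t => R u u * t) h2
          simp only [mul_add] at this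
          rw [← mul_assoc (R u u) Z, hZ1, ← mul_assoc] at this
          nth_rewrite 1 [← hZ1] at this
          rw [← mul_assoc, hpqp, smul_mul_assoc, hZ1] at this
          rw [sub_smul, one_smul, ← sub_eq_zero]
          rw [← sub_eq_zero] at this
          rw [← this]; abel
        have h3 : Z * R v v * R v v = Z * R v v := by rw [mul_assoc, hqq]
        rw [hZq, smul_mul_assoc, hZq] at h3
        rw [← sub_eq_zero] at h3
        rw [← neg_eq_zero, ← h3]
        module
      · have hZ1 : Z * R u u = Z := by rw [h, zero_add] at h1; exact h1
        have hZq : R v v * Z = (1 - c) • Z := by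
          have := congrArg (fun t => t * R u u) h2
          simp only [add_mul] at this
          rw [mul_assoc (R v v) Z, hZ1] at this
          nth_rewrite 2 [← hZ1] at this
          rw [mul_assoc, mul_assoc, ← mul_assoc (R u u), hpqp, mul_smul_comm, hZ1] at this
          rw [sub_smul, one_smul, ← sub_eq_zero]
          rw [← sub_eq_zero] at this
          rw [← this]; abel
        have h3 : R v v * (R v v * Z) = R v v * Z := by rw [← mul_assoc, hqq]
        rw [hZq, mul_smul_comm, hZq] at h3
        rw [← sub_eq_zero] at h3
        rw [← neg_eq_zero, ← h3]
        module
    rcases mul_eq_zero.1 ((smul_eq_zero.1 this).resolve_right hZ) with h | h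
    · left; exact h
    · right; exact (sub_eq_zero.1 h).symm
  rcases hc01 with h0 | h0
  · rw [R_mul]
    rcases mul_eq_zero.1 h0 with h | h
    · rw [h, zero_smul]
    · rw [star_dotProduct, h, star_zero, zero_smul]
  · exfalso
    rcases orth_decomp u v hu hv with he | ⟨y, s, r, hy, hxy, hyx, hzd, hsr⟩
    · exact hpq he
    · have hs1 : star u ⬝ᵥ v = s := by
        rw [hzd, dotProduct_add, dotProduct_smul, dotProduct_smul, hu, hxy]; simp
      have hs2 : star v ⬝ᵥ u = star s := by rw [star_dotProduct, hs1]
      rw [hc, hs1, hs2] at h0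
      have hr0 : (r : ℂ) = 0 := by
        rw [h0] at hsr
        exact mul_self_eq_zero.1 (by linear_combination hsr)
      rw [hr0, zero_smul, add_zero] at hzd
      apply hpq
      rw [hzd, R_smul_left, R_smul_right, smul_smul, h0, one_smul]

lemma R_single (i j : Fin m) : R (Pi.single i 1) (Pi.single j 1) = single i j (1 : ℂ) := by
  rw [R, ← Pi.single_star, star_one, ← single_eq_single_vecMulVec_single]

lemma pure_single (i : Fin m) : IsPureState (single i i (1 : ℂ)) := by
  rw [← R_single]; apply pure_of_unit
  rw [← Pi.single_star]; simp

lemma star_single_dot (i j : Fin m) :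
    star (Pi.single j (1 : ℂ) : Fin m → ℂ) ⬝ᵥ Pi.single i 1 = if i = j then 1 else 0 := by
  rw [← Pi.single_star, star_one]
  simp [Pi.single_apply]

lemma jordan_units (φ : Matrix (Fin m) (Fin m) ℂ →ₗ[ℂ] Matrix (Fin m) (Fin m) ℂ)
    (hφ : ∀ P, IsPureState P → IsPureState (φ P)) (i j k l : Fin m) :
    φ (single i j 1) * φ (single k l 1) + φ (single k l 1) * φ (single i j 1) +
      (φ (single i l 1) * φ (single k j 1) + φ (single k j 1) * φ (single i l 1)) =
    (if i = j then (1 : ℂ) else 0) • φ (single k l 1) +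
    (if k = l then (1 : ℂ) else 0) • φ (single i j 1) +
    ((if i = l then (1 : ℂ) else 0) • φ (single k j 1) +
    (if k = j then (1 : ℂ) else 0) • φ (single i l 1)) := by
  let β : Matrix (Fin m) (Fin m) ℂ →ₗ[ℂ] Matrix (Fin m) (Fin m) ℂ →ₗ[ℂ]
      Matrix (Fin m) (Fin m) ℂ := (LinearMap.mul ℂ (Matrix (Fin m) (Fin m) ℂ)).compl₁₂ φ φ
  have hβ : ∀ X Y, β X Y = φ X * φ Y := fun X Y => by simp [β]
  have := bil_polar β φ (fun P hP => by rw [hβ]; exact pure_idem (hφ P hP))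
    (Pi.single i 1) (Pi.single j 1) (Pi.single k 1) (Pi.single l 1)
  simpa only [hβ, R_single, star_single_dot] using this

lemma herm_preserving (φ : Matrix (Fin m) (Fin m) ℂ →ₗ[ℂ] Matrix (Fin m) (Fin m) ℂ)
    (hφ : ∀ P, IsPureState P → IsPureState (φ P)) (X : Matrix (Fin m) (Fin m) ℂ) :
    φ Xᴴ = (φ X)ᴴ := by
  let φ' : Matrix (Fin m) (Fin m) ℂ →ₗ[ℂ] Matrix (Fin m) (Fin m) ℂ :=
    { toFun := fun X => (φ Xᴴ)ᴴ
      map_add' := fun X Y => by simp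
      map_smul' := fun c X => by simp }
  have : φ' = φ := lin_ext_eq _ _ fun P hP => by
    change (φ Pᴴ)ᴴ = φ P
    rw [hP.1.eq, (hφ P hP).1.eq]
  have h := LinearMap.congr_fun this X
  change (φ Xᴴ)ᴴ = φ X at h
  rw [← h, conjTranspose_conjTranspose]

lemma trace_preserving (φ : Matrix (Fin m) (Fin m) ℂ →ₗ[ℂ] Matrix (Fin m) (Fin m) ℂ)
    (hφ : ∀ P, IsPureState P → IsPureState (φ P)) (X : Matrix (Fin m) (Fin m) ℂ) :
    (φ X).trace = X.trace := by
  have : (traceLinearMap (Fin m) ℂ ℂ).comp φ = traceLinearMap (Fin m) ℂ ℂ :=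
    lin_ext_eq _ _ fun P hP => by
      simp [(hφ P hP).2.2, hP.2.2]
  simpa using LinearMap.congr_fun this X

/-- facts about images of matrix units -/
lemma unit_facts (φ : Matrix (Fin m) (Fin m) ℂ →ₗ[ℂ] Matrix (Fin m) (Fin m) ℂ)
    (hφ : ∀ P, IsPureState P → IsPureState (φ P)) (hinj : Function.Injective φ)
    {i j : Fin m} (hij : i ≠ j) :
    φ (single i j 1) ≠ 0 ∧
    φ (single i i 1) * φ (single i j 1) + φ (single i j 1) * φ (single i i 1) = φ (single i j 1) ∧
    φ (single j j 1) * φ (single i j 1) + φ (single i j 1) * φ (single j j 1) = φ (single i j 1) ∧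
    φ (single i i 1) * φ (single j j 1) = 0 ∧
    (φ (single i j 1) * φ (single i i 1) = 0 ∨ φ (single i i 1) * φ (single i j 1) = 0) ∧
    (φ (single i j 1) * φ (single j j 1) = 0 ∨ φ (single j j 1) * φ (single i j 1) = 0) := by
  have hJ := jordan_units φ hφ
  have two : ∀ X Y : Matrix (Fin m) (Fin m) ℂ, X + X = Y + Y → X = Y := by
    intro X Y h
    rw [← two_smul ℂ X, ← two_smul ℂ Y] at h
    exact smul_right_injective _ (two_ne_zero) h
  have n0 : φ (single i j 1) ≠ 0 := by
    rw [← map_zero φ]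
    intro h
    have := congrFun (congrFun (hinj h) i) j
    simp at this
  have n1 : φ (single i i 1) ≠ φ (single j j 1) := by
    intro h
    have := congrFun (congrFun (hinj h) i) i
    simp [single_apply, hij.symm] at this
  have a1 := hJ i j i j
  have a2 := hJ i i i j
  have a3 := hJ i j j j
  simp only [hij, hij.symm, if_true, if_false, one_smul, zero_smul, add_zero, zero_add]
    at a1 a2 a3
  have b1 : φ (single i j 1) * φ (single i j 1) = 0 := by
    have := two _ 0 (by rw [a1]; simp)
    exact two _ 0 (by rw [this]; simp)
  have b2 := two _ _ ((by rw [← a2]; abel :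
    (φ (single i i 1) * φ (single i j 1) + φ (single i j 1) * φ (single i i 1)) +
    (φ (single i i 1) * φ (single i j 1) + φ (single i j 1) * φ (single i i 1)) = _))
  have b3 := two _ _ ((by rw [← a3]; abel :
    (φ (single j j 1) * φ (single i j 1) + φ (single i j 1) * φ (single j j 1)) +
    (φ (single j j 1) * φ (single i j 1) + φ (single i j 1) * φ (single j j 1)) = _))
  have o := orth_of_jordan (hφ _ (pure_single i)) (hφ _ (pure_single j)) n1 n0 b1 b2 b3
  have o' := orth_of_jordan (hφ _ (pure_single j)) (hφ _ (pure_single i)) n1.symm n0 b1 b3 b2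
  exact ⟨n0, b2, b3, o.1, o.2, o'.2⟩

/-- For distinct indices, `Z_ij = Z_ik Z_kj + Z_kj Z_ik`, with `p_k` killing `Z_ij`. -/
lemma unit_facts3 (φ : Matrix (Fin m) (Fin m) ℂ →ₗ[ℂ] Matrix (Fin m) (Fin m) ℂ)
    (hφ : ∀ P, IsPureState P → IsPureState (φ P)) (hinj : Function.Injective φ)
    {i j k : Fin m} (hij : i ≠ j) (hik : i ≠ k) (hjk : j ≠ k) :
    φ (single k k 1) * φ (single i j 1) = 0 ∧ φ (single i j 1) * φ (single k k 1) = 0 ∧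
    φ (single i k 1) * φ (single k j 1) + φ (single k j 1) * φ (single i k 1) =
      φ (single i j 1) := by
  obtain ⟨-, b2, b3, -, -, -⟩ := unit_facts φ hφ hinj hij
  have ki := (unit_facts φ hφ hinj hik.symm).2.2.2.1
  have ik := (unit_facts φ hφ hinj hik).2.2.2.1
  have kj := (unit_facts φ hφ hinj hjk.symm).2.2.2.1
  have jk := (unit_facts φ hφ hinj hjk).2.2.2.1
  have ij := (unit_facts φ hφ hinj hij).2.2.2.1
  have ji := (unit_facts φ hφ hinj hij.symm).2.2.2.1
  have hJ := jordan_units φ hφ i k k j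
  simp only [hik, hjk.symm, hij, if_true, if_false, one_smul, zero_smul, add_zero, zero_add] at hJ
  have l1 : φ (single k k 1) * φ (single i j 1) =
      φ (single k k 1) * φ (single i j 1) * φ (single i i 1) := by
    conv_lhs => rw [← b2]
    rw [mul_add, ← mul_assoc, ki, zero_mul, zero_add, mul_assoc]
  have l2 : φ (single k k 1) * φ (single i j 1) =
      φ (single k k 1) * φ (single i j 1) * φ (single j j 1) := by
    conv_lhs => rw [← b3]
    rw [mul_add, ← mul_assoc, kj, zero_mul, zero_add, mul_assoc]
  have l3 : φ (single k k 1) * φ (single i j 1) = 0 := by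
    rw [l1, l2, mul_assoc, ji, mul_zero]
  have r1 : φ (single i j 1) * φ (single k k 1) =
      φ (single i i 1) * (φ (single i j 1) * φ (single k k 1)) := by
    conv_lhs => rw [← b2]
    rw [add_mul, mul_assoc _ (φ (single i i 1)), ik, mul_zero, add_zero, mul_assoc]
  have r2 : φ (single i j 1) * φ (single k k 1) =
      φ (single j j 1) * (φ (single i j 1) * φ (single k k 1)) := by
    conv_lhs => rw [← b3]
    rw [add_mul, mul_assoc _ (φ (single j j 1)), jk, mul_zero, add_zero, mul_assoc]
  have r3 : φ (single i j 1) * φ (single k k 1) = 0 := by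
    rw [r1, r2, ← mul_assoc, ij, zero_mul]
  refine ⟨l3, r3, ?_⟩
  rw [l3, r3] at hJ
  simpa using hJ

end wigner
end PNR

namespace PNR
section wigner2
variable {m : ℕ}

lemma wigner_aux (φ : Matrix (Fin m) (Fin m) ℂ →ₗ[ℂ] Matrix (Fin m) (Fin m) ℂ)
    (hφ : ∀ P, IsPureState P → IsPureState (φ P)) (hinj : Function.Injective φ) (o : Fin m)
    (ho : ∀ i, i ≠ o → φ (single o o 1) * φ (single i o 1) = 0) :
    ∃ V ∈ Matrix.unitaryGroup (Fin m) ℂ, ∀ X, φ X = V * X * Vᴴ := by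
  have hpp : φ (single o o 1) * φ (single o o 1) = φ (single o o 1) :=
    pure_idem (hφ _ (pure_single o))
  have hst : ∀ i j, (φ (single i j 1))ᴴ = φ (single j i 1) := by
    intro i j
    rw [← herm_preserving φ hφ]; simp
  have e1 : ∀ i, φ (single i o 1) * φ (single o o 1) = φ (single i o 1) := by
    intro i
    by_cases hi : i = o
    · rw [hi, hpp]
    · have := (unit_facts φ hφ hinj hi).2.2.1
      rw [ho i hi, zero_add] at this
      exact this
  have e2 : ∀ i, φ (single o o 1) * φ (single o i 1) = φ (single o i 1) := by
    intro i
    have := congrArg conjTranspose (e1 i)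
    rwa [conjTranspose_mul, hst, hst] at this
  have key : ∀ i j, φ (single i j 1) = φ (single i o 1) * φ (single o j 1) := by
    intro i j
    by_cases hi : i = o
    · rw [hi, e2]
    by_cases hj : j = o
    · rw [hj, e1]
    have hcomp : φ (single o j 1) * φ (single i o 1) =
        φ (single o o 1) * (φ (single o j 1) * φ (single i o 1)) * φ (single o o 1) := by
      rw [← mul_assoc, e2, mul_assoc, e1]
    by_cases hij : i = j
    · subst hij
      have hJ := jordan_units φ hφ i o o i
      have z1 := (unit_facts φ hφ hinj hi).2.2.2.1
      have z2 := (unit_facts φ hφ hinj (Ne.symm hi)).2.2.2.1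
      simp only [hi, Ne.symm hi, if_true, if_false, one_smul, zero_smul, add_zero, zero_add,
        z1, z2] at hJ
      have h3 : φ (single o i 1) * φ (single i o 1) = φ (single o o 1) := by
        rw [hcomp]
        have : φ (single o i 1) * φ (single i o 1) =
            φ (single o o 1) + φ (single i i 1) - φ (single i o 1) * φ (single o i 1) := by
          rw [← hJ]; abel
        rw [this, mul_sub, mul_add, ← mul_assoc, ho i hi, hpp, z2]
        simp [hpp]
      rw [h3, add_comm] at hJ
      exact (add_left_cancel hJ).symm
    · obtain ⟨h1, h2, h3⟩ := unit_facts3 φ hφ hinj hij hi hj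
      have h4 : φ (single o j 1) * φ (single i o 1) = 0 := by
        rw [hcomp]
        have : φ (single o j 1) * φ (single i o 1) =
            φ (single i j 1) - φ (single i o 1) * φ (single o j 1) := by
          rw [← h3]; abel
        rw [this, mul_sub, ← mul_assoc, ho i hi, h1]
        simp
      rw [h4, add_zero] at h3
      exact h3.symm
  obtain ⟨u, hu, hpu⟩ := exists_unit_of_pure (hφ _ (pure_single o))
  let v : Fin m → Fin m → ℂ := fun i => φ (single i o 1) *ᵥ u
  have hv : ∀ i j, φ (single i j 1) = R (v i) (v j) := by
    intro i j
    rw [key, ← e1 i, hpu]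
    simp only [R, mul_vecMulVec, vecMulVec_mul]
    congr 1
    simp only [v]
    rw [star_mulVec, hst]
  let V : Matrix (Fin m) (Fin m) ℂ := of fun k i => v i k
  refine ⟨V, ?_, ?_⟩
  · rw [mem_unitaryGroup_iff', star_eq_conjTranspose]
    ext i j
    have h1 := trace_preserving φ hφ (single j i 1)
    rw [hv, R_trace] at h1
    have h2 : (Vᴴ * V) i j = star (v i) ⬝ᵥ v j := by
      simp [mul_apply, dotProduct, V]
    rw [h2, h1]
    by_cases hij : i = j
    · subst hij; simp
    · rw [one_apply_ne hij, trace_single_eq_of_ne _ _ _ (Ne.symm hij)]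
  · let L : Matrix (Fin m) (Fin m) ℂ →ₗ[ℂ] Matrix (Fin m) (Fin m) ℂ :=
      (LinearMap.mulRight ℂ Vᴴ).comp (LinearMap.mulLeft ℂ V)
    have hL : φ = L := by
      apply Matrix.ext_linearMap
      intro i j
      apply LinearMap.ext_ring
      change φ (single i j 1) = V * single i j 1 * Vᴴ
      rw [hv, ← R_single, R, R, mul_vecMulVec, vecMulVec_mul]
      congr 1
      · ext k; simp [V]
      · rw [← Pi.single_star]; ext k; simp [V]
    intro X
    exact LinearMap.congr_fun hL X

lemma pure_transpose {P : Matrix (Fin m) (Fin m) ℂ} (hP : IsPureState P) : IsPureState Pᵀ :=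
  ⟨hP.1.transpose, by rw [rank_transpose]; exact hP.2.1, by rw [trace_transpose]; exact hP.2.2⟩

lemma wigner (hm : 0 < m) (φ : Matrix (Fin m) (Fin m) ℂ →ₗ[ℂ] Matrix (Fin m) (Fin m) ℂ)
    (hφ : ∀ P, IsPureState P → IsPureState (φ P)) (hinj : Function.Injective φ) :
    ∃ V ∈ Matrix.unitaryGroup (Fin m) ℂ, (∀ X, φ X = V * X * Vᴴ) ∨ (∀ X, φ X = V * Xᵀ * Vᴴ) := by
  let o : Fin m := ⟨0, hm⟩
  have hst : ∀ i j, (φ (single i j 1))ᴴ = φ (single j i 1) := by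
    intro i j
    rw [← herm_preserving φ hφ]; simp
  have dich : (∀ i, i ≠ o → φ (single o o 1) * φ (single i o 1) = 0) ∨
      (∀ i, i ≠ o → φ (single i o 1) * φ (single o o 1) = 0) := by
    by_contra hc
    push Not at hc
    obtain ⟨⟨i, hi, hi'⟩, ⟨j, hj, hj'⟩⟩ := hc
    obtain ⟨i0, -, i3, -, -, i6⟩ := unit_facts φ hφ hinj hi
    obtain ⟨j0, -, j3, -, -, j6⟩ := unit_facts φ hφ hinj hj
    have i7 := i6.resolve_right hi'
    have j7 := j6.resolve_left hj'
    by_cases hij : i = j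
    · subst hij; exact hj' i7
    · obtain ⟨k0, -⟩ := unit_facts φ hφ hinj hij
      obtain ⟨-, -, h3⟩ := unit_facts3 φ hφ hinj hij hi hj
      apply k0
      rw [i7, add_zero] at i3
      rw [j7, zero_add] at j3
      have j8 := congrArg conjTranspose j7
      have j9 := congrArg conjTranspose j3
      rw [conjTranspose_mul, hst, hst, conjTranspose_zero] at j8
      rw [conjTranspose_mul, hst, hst] at j9
      rw [← h3]
      nth_rewrite 1 [← j9]
      rw [← mul_assoc, i7, zero_mul, zero_add, ← i3, ← mul_assoc, j8, zero_mul]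
  rcases dich with h | h
  · obtain ⟨V, hV, hX⟩ := wigner_aux φ hφ hinj o h
    exact ⟨V, hV, Or.inl hX⟩
  · let φ' : Matrix (Fin m) (Fin m) ℂ →ₗ[ℂ] Matrix (Fin m) (Fin m) ℂ :=
      φ.comp (transposeLinearEquiv (Fin m) (Fin m) ℂ ℂ).toLinearMap
    have hφ' : ∀ X, φ' X = φ Xᵀ := fun X => rfl
    obtain ⟨V, hV, hX⟩ := wigner_aux φ' (fun P hP => hφ _ (pure_transpose hP))
      (fun X Y hXY => by
        have := hinj (a₁ := Xᵀ) (a₂ := Yᵀ) hXY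
        exact transpose_injective this) o (by
        intro i hi
        rw [hφ', hφ', transpose_single, transpose_single]
        have := congrArg conjTranspose (h i hi)
        rwa [conjTranspose_mul, hst, hst, conjTranspose_zero] at this)
    refine ⟨V, hV, Or.inr fun X => ?_⟩
    rw [← hX, hφ', transpose_transpose]

end wigner2
end PNR

namespace PNR

/-- Pure product states. -/
def IsPP {m n : ℕ} (X : Matrix (Fin m × Fin n) (Fin m × Fin n) ℂ) : Prop :=
  ∃ P Q, IsPureState P ∧ IsPureState Q ∧ X = P ⊗ₖ Q

section s6
variable {m n : ℕ}
open scoped ComplexOrder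

/-- The Kronecker product as a bilinear map. -/
noncomputable def kb (m n : ℕ) : Matrix (Fin m) (Fin m) ℂ →ₗ[ℂ] Matrix (Fin n) (Fin n) ℂ →ₗ[ℂ]
    Matrix (Fin m × Fin n) (Fin m × Fin n) ℂ := kroneckerBilinear (R := ℂ)

lemma kb_apply (A : Matrix (Fin m) (Fin m) ℂ) (B : Matrix (Fin n) (Fin n) ℂ) :
    kb m n A B = A ⊗ₖ B := rfl

lemma IsPP.herm {X : Matrix (Fin m × Fin n) (Fin m × Fin n) ℂ} (h : IsPP X) : Xᴴ = X := by
  obtain ⟨P, Q, hP, hQ, rfl⟩ := h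
  rw [conjTranspose_kronecker, hP.1.eq, hQ.1.eq]

lemma IsPP.trace_sq {X : Matrix (Fin m × Fin n) (Fin m × Fin n) ℂ} (h : IsPP X) :
    (X * X).trace = 1 := by
  obtain ⟨P, Q, hP, hQ, rfl⟩ := h
  rw [← mul_kronecker_mul, pure_idem hP, pure_idem hQ, trace_kronecker, hP.2.2, hQ.2.2, mul_one]

lemma range_iff (T : Matrix (Fin m × Fin n) (Fin m × Fin n) ℂ) (z : ℂ) :
    z ∈ prodNumRange T ↔ ∃ X, IsPP X ∧ z = (T * X).trace := by
  constructor
  · rintro ⟨P, Q, hP, hQ, h⟩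
    exact ⟨_, ⟨P, Q, hP, hQ, rfl⟩, h⟩
  · rintro ⟨_, ⟨P, Q, hP, hQ, rfl⟩, h⟩
    exact ⟨P, Q, hP, hQ, h⟩

lemma adj_star {Ψ ΨStar : Matrix (Fin m × Fin n) (Fin m × Fin n) ℂ →ₗ[ℂ]
        Matrix (Fin m × Fin n) (Fin m × Fin n) ℂ}
    (hadj : ∀ X Y, (Ψ X * Yᴴ).trace = (X * (ΨStar Y)ᴴ).trace)
    (T X : Matrix (Fin m × Fin n) (Fin m × Fin n) ℂ) (hX : IsPP X) :
    (ΨStar T * X).trace = (T * (Ψ X)ᴴ).trace := by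
  have h := congrArg star (hadj X T)
  rw [← trace_conjTranspose, ← trace_conjTranspose, conjTranspose_mul, conjTranspose_mul,
    conjTranspose_conjTranspose, conjTranspose_conjTranspose, hX.herm] at h
  exact h.symm

lemma hull_le (S : Set ℂ) (c : ℝ) : convexHull ℝ S ⊆ {z | z.re ≤ c} ↔ ∀ z ∈ S, z.re ≤ c := by
  constructor
  · intro h z hz
    exact h (subset_convexHull ℝ S hz)
  · intro h
    apply convexHull_min h
    exact convex_halfSpace_le (f := fun z : ℂ => z.re) ⟨Complex.add_re, by simp⟩ c

lemma star_equiv {Ψ ΨStar : Matrix (Fin m × Fin n) (Fin m × Fin n) ℂ →ₗ[ℂ]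
        Matrix (Fin m × Fin n) (Fin m × Fin n) ℂ}
    (hadj : ∀ X Y, (Ψ X * Yᴴ).trace = (X * (ΨStar Y)ᴴ).trace)
    (hb : ∀ T, convexHull ℝ (prodNumRange (ΨStar T)) = convexHull ℝ (prodNumRange T))
    (T : Matrix (Fin m × Fin n) (Fin m × Fin n) ℂ) (c : ℝ) :
    (∀ Y, IsPP Y → (T * Y).trace.re ≤ c) ↔ (∀ Y, IsPP Y → (T * (Ψ Y)ᴴ).trace.re ≤ c) := by
  have h : convexHull ℝ (prodNumRange (ΨStar T)) ⊆ {z | z.re ≤ c} ↔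
    convexHull ℝ (prodNumRange T) ⊆ {z | z.re ≤ c} := by rw [hb]
  rw [hull_le, hull_le] at h
  constructor
  · intro h1 Y hY
    rw [← adj_star hadj T Y hY]
    refine h.2 ?_ _ ((range_iff _ _).2 ⟨Y, hY, rfl⟩)
    intro z hz
    obtain ⟨X, hX, rfl⟩ := (range_iff _ _).1 hz
    exact h1 X hX
  · intro h1 Y hY
    refine h.1 ?_ _ ((range_iff _ _).2 ⟨Y, hY, rfl⟩)
    intro z hz
    obtain ⟨X, hX, rfl⟩ := (range_iff _ _).1 hz
    rw [adj_star hadj T X hX]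
    exact h1 X hX

lemma hs_nonneg (Z : Matrix (Fin m × Fin n) (Fin m × Fin n) ℂ) : 0 ≤ (Z * Zᴴ).trace := by
  exact (posSemidef_self_mul_conjTranspose Z).trace_nonneg

lemma hs_expand (W Z : Matrix (Fin m × Fin n) (Fin m × Fin n) ℂ) :
    ((W - Z) * (W - Z)ᴴ).trace.re =
      (W * Wᴴ).trace.re + (Z * Zᴴ).trace.re - 2 * (W * Zᴴ).trace.re := by
  have h : (Z * Wᴴ).trace.re = (W * Zᴴ).trace.re := by
    have : (Z * Wᴴ) = (W * Zᴴ)ᴴ := by simp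
    rw [this, trace_conjTranspose]; simp
  rw [conjTranspose_sub, sub_mul, mul_sub, mul_sub]
  simp only [trace_sub, Complex.sub_re, h]
  ring

lemma isCompact_unit (m : ℕ) : IsCompact {x : Fin m → ℂ | star x ⬝ᵥ x = 1} := by
  apply Metric.isCompact_of_isClosed_isBounded
  · apply isClosed_eq _ continuous_const
    simp only [dotProduct, Pi.star_apply]
    fun_prop
  · refine (Metric.isBounded_closedBall (x := (0 : Fin m → ℂ)) (r := 1)).subset ?_
    intro x hx
    simp only [Set.mem_ofPred_eq, star_dot_self] at hx
    have hx' : ∑ i, ‖x i‖ ^ 2 = 1 := by exact_mod_cast hx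
    rw [mem_closedBall_zero_iff, pi_norm_le_iff_of_nonneg zero_le_one]
    intro i
    have : ‖x i‖ ^ 2 ≤ 1 := by
      rw [← hx']
      exact Finset.single_le_sum (f := fun i => ‖x i‖ ^ 2) (fun j _ => by positivity) (Finset.mem_univ i)
    nlinarith [norm_nonneg (x i)]

lemma exists_max (f : Matrix (Fin m × Fin n) (Fin m × Fin n) ℂ → ℝ) (hf : Continuous f)
    (hne : ∃ X : Matrix (Fin m × Fin n) (Fin m × Fin n) ℂ, IsPP X) :
    ∃ Y, IsPP Y ∧ ∀ Z, IsPP Z → f Z ≤ f Y := by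
  have hc := (isCompact_unit m).prod (isCompact_unit n)
  have hg : Continuous fun p : (Fin m → ℂ) × (Fin n → ℂ) => f (R p.1 p.1 ⊗ₖ R p.2 p.2) := by
    apply hf.comp
    apply continuous_matrix
    intro i j
    simp only [kroneckerMap_apply, R, vecMulVec_apply, Pi.star_apply]
    fun_prop
  obtain ⟨_, P, Q, hP, hQ, -⟩ := hne
  obtain ⟨x, hx, -⟩ := exists_unit_of_pure hP
  obtain ⟨y, hy, -⟩ := exists_unit_of_pure hQ
  obtain ⟨p, hp, hmax⟩ := hc.exists_isMaxOn ⟨(x, y), hx, hy⟩ hg.continuousOn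
  refine ⟨R p.1 p.1 ⊗ₖ R p.2 p.2, ⟨_, _, pure_of_unit _ hp.1, pure_of_unit _ hp.2, rfl⟩, ?_⟩
  rintro _ ⟨P, Q, hP, hQ, rfl⟩
  obtain ⟨x, hx, rfl⟩ := exists_unit_of_pure hP
  obtain ⟨y, hy, rfl⟩ := exists_unit_of_pure hQ
  exact hmax (show (x, y) ∈ _ from ⟨hx, hy⟩)

lemma pp_preimage {Ψ ΨStar : Matrix (Fin m × Fin n) (Fin m × Fin n) ℂ →ₗ[ℂ]
        Matrix (Fin m × Fin n) (Fin m × Fin n) ℂ}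
    (hadj : ∀ X Y, (Ψ X * Yᴴ).trace = (X * (ΨStar Y)ᴴ).trace)
    (hb : ∀ T, convexHull ℝ (prodNumRange (ΨStar T)) = convexHull ℝ (prodNumRange T))
    (X : Matrix (Fin m × Fin n) (Fin m × Fin n) ℂ) (hX : IsPP X) : ∃ Y, IsPP Y ∧ Ψ Y = X := by
  have hΨ : Continuous Ψ := Ψ.continuous_of_finiteDimensional
  have hst := star_equiv hadj hb
  obtain ⟨Y, hY, hmax⟩ := exists_max (fun Z => (X * (Ψ Z)ᴴ).trace.re)
    (Complex.continuous_re.comp ((continuous_const.matrix_mul hΨ.matrix_conjTranspose).matrix_trace))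
    ⟨X, hX⟩
  have h1 : 1 ≤ (X * (Ψ Y)ᴴ).trace.re := by
    have := (hst X _).2 hmax X hX
    rwa [hX.trace_sq] at this
  have h2 : (Ψ Y * (Ψ Y)ᴴ).trace.re ≤ 1 := by
    have := (hst (Ψ Y) ((1 + (Ψ Y * (Ψ Y)ᴴ).trace.re) / 2)).1 ?_ Y hY
    · linarith
    · intro W hW
      have h3 := (Complex.le_def.1 (hs_nonneg (Ψ Y - W))).1
      rw [hs_expand, hW.herm, hW.trace_sq] at h3
      simp only [Complex.zero_re, Complex.one_re] at h3
      linarith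
  refine ⟨Y, hY, ?_⟩
  have h3 : ((X - Ψ Y) * (X - Ψ Y)ᴴ).trace.re ≤ 0 := by
    rw [hs_expand, hX.herm, hX.trace_sq, Complex.one_re]
    linarith
  have h4 := Complex.le_def.1 (hs_nonneg (X - Ψ Y))
  have h5 : ((X - Ψ Y) * (X - Ψ Y)ᴴ).trace = 0 := by
    apply Complex.ext
    · exact le_antisymm h3 h4.1
    · exact h4.2.symm
  rw [trace_mul_conjTranspose_self_eq_zero_iff, sub_eq_zero] at h5
  exact h5.symm

lemma span_PP (N : Submodule ℂ (Matrix (Fin m × Fin n) (Fin m × Fin n) ℂ))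
    (h : ∀ P, IsPP P → P ∈ N) : N = ⊤ := by
  have h1 : ∀ (A : Matrix (Fin m) (Fin m) ℂ) (B : Matrix (Fin n) (Fin n) ℂ), A ⊗ₖ B ∈ N := by
    have h2 : ∀ (P : Matrix (Fin m) (Fin m) ℂ), IsPureState P →
        ∀ (B : Matrix (Fin n) (Fin n) ℂ), P ⊗ₖ B ∈ N := by
      intro P hP B
      have := span_pure (N.comap (kb m n P)) fun Q hQ => h _ ⟨P, Q, hP, hQ, rfl⟩
      exact this.ge (x := B) trivial
    intro A B
    have := span_pure (N.comap ((kb m n).flip B)) fun P hP => h2 P hP B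
    exact this.ge (x := A) trivial
  rw [eq_top_iff]
  intro X _
  rw [matrix_eq_sum_single X]
  refine Submodule.sum_mem _ fun p _ => Submodule.sum_mem _ fun q _ => ?_
  have : single p q (X p q) = single p.1 q.1 (X p q) ⊗ₖ single p.2 q.2 (1 : ℂ) := by
    rw [single_kronecker_single, mul_one]
  rw [this]
  exact h1 _ _

lemma pp_bij {Ψ ΨStar : Matrix (Fin m × Fin n) (Fin m × Fin n) ℂ →ₗ[ℂ]
        Matrix (Fin m × Fin n) (Fin m × Fin n) ℂ}
    (hadj : ∀ X Y, (Ψ X * Yᴴ).trace = (X * (ΨStar Y)ᴴ).trace)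
    (hb : ∀ T, convexHull ℝ (prodNumRange (ΨStar T)) = convexHull ℝ (prodNumRange T)) :
    Function.Injective Ψ ∧ ∀ Y, IsPP Y → IsPP (Ψ Y) := by
  have hs : Function.Surjective Ψ := by
    rw [← LinearMap.range_eq_top]
    apply span_PP
    intro P hP
    obtain ⟨Y, _, hY⟩ := pp_preimage hadj hb P hP
    exact ⟨Y, hY⟩
  have hi : Function.Injective Ψ := LinearMap.injective_iff_surjective.2 hs
  have hi' : Function.Injective ΨStar := by
    rw [injective_iff_map_eq_zero]
    intro Y hY
    obtain ⟨X, hX⟩ := hs Y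
    have := hadj X Y
    rw [hX, hY, conjTranspose_zero, mul_zero, trace_zero,
      trace_mul_conjTranspose_self_eq_zero_iff] at this
    exact this
  refine ⟨hi, ?_⟩
  let e := LinearEquiv.ofInjectiveEndo Ψ hi
  let e' := LinearEquiv.ofInjectiveEndo ΨStar hi'
  have he : ∀ X, Ψ (e.symm X) = X := fun X => e.apply_symm_apply X
  have he' : ∀ X, ΨStar (e'.symm X) = X := fun X => e'.apply_symm_apply X
  intro Y hY
  obtain ⟨Z, hZ, hZY⟩ := pp_preimage (Ψ := e.symm.toLinearMap) (ΨStar := e'.symm.toLinearMap)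
    (fun X Y => by
      have := hadj (e.symm X) (e'.symm Y)
      rw [he, he'] at this
      exact this.symm)
    (fun T => by
      have := hb (e'.symm T)
      rw [he'] at this
      exact this.symm) Y hY
  have : Ψ Y = Z := by rw [← hZY]; exact he Z
  rw [this]; exact hZ

end s6
end PNR

namespace PNR

lemma comb {α β γ δ : Type*} (F : α → β → γ) (G : α → β → δ)
    (inj : ∀ a b a' b', F a b = F a' b' → G a b = G a' b' → a = a' ∧ b = b')
    (surj : ∀ c d, ∃ a b, F a b = c ∧ G a b = d)
    (hA : ∀ b, (∀ a a', F a b = F a' b) ∨ (∀ a a', G a b = G a' b))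
    (hB : ∀ a, (∀ b b', F a b = F a b') ∨ (∀ b b', G a b = G a b'))
    (a₁ a₂ a₃ : α) (h12 : a₁ ≠ a₂) (h13 : a₁ ≠ a₃) (h23 : a₂ ≠ a₃)
    (c₁ c₂ : γ) (hc : c₁ ≠ c₂) (d₁ d₂ : δ) (hd : d₁ ≠ d₂) :
    ((∀ a b b', F a b = F a b') ∧ (∀ a a' b, G a b = G a' b)) ∨
      ((∀ a a' b, F a b = F a' b) ∧ ∀ a b b', G a b = G a b') := by
  by_cases hG : ∀ a a' b, G a b = G a' b
  · left
    refine ⟨fun a => ?_, hG⟩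
    rcases hB a with h | h
    · exact h
    · exfalso
      obtain ⟨x, y, -, h1⟩ := surj c₁ d₁
      obtain ⟨x', y', -, h2⟩ := surj c₁ d₂
      apply hd
      rw [← h1, ← h2, hG x a y, hG x' a y', h]
  by_cases hF : ∀ a a' b, F a b = F a' b
  · right
    refine ⟨hF, fun a => ?_⟩
    rcases hB a with h | h
    · exfalso
      obtain ⟨x, y, h1, -⟩ := surj c₁ d₁
      obtain ⟨x', y', h2, -⟩ := surj c₂ d₁
      apply hc
      rw [← h1, ← h2, hF x a y, hF x' a y', h]
    · exact h
  exfalso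
  push Not at hG hF
  obtain ⟨u, u', b₁, hu⟩ := hG
  obtain ⟨v, v', b₂, hv⟩ := hF
  have hF1 : ∀ a a', F a b₁ = F a' b₁ := (hA b₁).resolve_right fun h => hu (h _ _)
  have hG2 : ∀ a a', G a b₂ = G a' b₂ := (hA b₂).resolve_left fun h => hv (h _ _)
  have key : ∀ a, F a b₂ = F a₁ b₁ ∨ G a b₁ = G a₁ b₂ := by
    intro a
    rcases hB a with h | h
    · left; rw [h b₂ b₁]; exact hF1 _ _
    · right; rw [h b₁ b₂]; exact hG2 _ _
  have eF : ∀ a a', F a b₂ = F a₁ b₁ → F a' b₂ = F a₁ b₁ → a = a' := fun a a' h h' =>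
    (inj a b₂ a' b₂ (h.trans h'.symm) (hG2 _ _)).1
  have eG : ∀ a a', G a b₁ = G a₁ b₂ → G a' b₁ = G a₁ b₂ → a = a' := fun a a' h h' =>
    (inj a b₁ a' b₁ (hF1 _ _) (h.trans h'.symm)).1
  rcases key a₁ with h1 | h1 <;> rcases key a₂ with h2 | h2 <;> rcases key a₃ with h3 | h3
  · exact h12 (eF _ _ h1 h2)
  · exact h12 (eF _ _ h1 h2)
  · exact h13 (eF _ _ h1 h3)
  · exact h23 (eG _ _ h2 h3)
  · exact h23 (eF _ _ h2 h3)
  · exact h13 (eG _ _ h1 h3)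
  · exact h12 (eG _ _ h1 h2)
  · exact h12 (eG _ _ h1 h2)

lemma three_pure (m : ℕ) (hm : 2 ≤ m) : ∃ P₁ P₂ P₃ : {P : Matrix (Fin m) (Fin m) ℂ // IsPureState P},
    P₁ ≠ P₂ ∧ P₁ ≠ P₃ ∧ P₂ ≠ P₃ := by
  let i : Fin m := ⟨0, by omega⟩
  let j : Fin m := ⟨1, by omega⟩
  have hij : i ≠ j := by simp [i, j]
  have hx0 : (Pi.single i 1 + Pi.single j 1 : Fin m → ℂ) ≠ 0 := by
    intro h
    have := congrFun h i
    simp [hij] at this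
  obtain ⟨r, y, hr, hy, hxy, -⟩ := exists_normalize _ hx0
  have hyi : y i ≠ 0 := by
    intro h
    have := congrFun hxy i
    simp [hij, h] at this
  have hyj : y j ≠ 0 := by
    intro h
    have := congrFun hxy j
    simp [hij, hij.symm, h] at this
  refine ⟨⟨_, pure_single i⟩, ⟨_, pure_single j⟩, ⟨_, pure_of_unit y hy⟩, ?_, ?_, ?_⟩
  · intro h
    have := congrFun (congrFun (congrArg Subtype.val h) i) i
    simp [single_apply, hij, hij.symm] at this
  · intro h
    have := congrFun (congrFun (congrArg Subtype.val h) i) j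
    simp [single_apply, hij, hij.symm, R, vecMulVec_apply, hyi, hyj] at this
  · intro h
    have := congrFun (congrFun (congrArg Subtype.val h) i) j
    simp [single_apply, hij, hij.symm, R, vecMulVec_apply, hyi, hyj] at this

section s7
variable {m n : ℕ}

/-- Partial trace over the second factor. -/
noncomputable def ptr2 (m n : ℕ) : Matrix (Fin m × Fin n) (Fin m × Fin n) ℂ →ₗ[ℂ] Matrix (Fin m) (Fin m) ℂ where
  toFun X := Matrix.of fun i j => ∑ k, X (i, k) (j, k)
  map_add' X Y := by ext i j; simp [Finset.sum_add_distrib]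
  map_smul' c X := by ext i j; simp [Finset.mul_sum]

/-- Partial trace over the first factor. -/
noncomputable def ptr1 (m n : ℕ) : Matrix (Fin m × Fin n) (Fin m × Fin n) ℂ →ₗ[ℂ] Matrix (Fin n) (Fin n) ℂ where
  toFun X := Matrix.of fun i j => ∑ k, X (k, i) (k, j)
  map_add' X Y := by ext i j; simp [Finset.sum_add_distrib]
  map_smul' c X := by ext i j; simp [Finset.mul_sum]

lemma ptr2_kron (A : Matrix (Fin m) (Fin m) ℂ) (B : Matrix (Fin n) (Fin n) ℂ) :
    ptr2 m n (A ⊗ₖ B) = B.trace • A := by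
  ext i j
  simp [ptr2, Matrix.trace, Finset.mul_sum, mul_comm]

lemma ptr1_kron (A : Matrix (Fin m) (Fin m) ℂ) (B : Matrix (Fin n) (Fin n) ℂ) :
    ptr1 m n (A ⊗ₖ B) = A.trace • B := by
  ext i j
  simp [ptr1, Matrix.trace, Finset.sum_mul]

lemma pure_kron_inj {A A' : Matrix (Fin m) (Fin m) ℂ} {B B' : Matrix (Fin n) (Fin n) ℂ}
    (hA : IsPureState A) (hB : IsPureState B) (hA' : IsPureState A') (hB' : IsPureState B')
    (h : A ⊗ₖ B = A' ⊗ₖ B') : A = A' ∧ B = B' := by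
  have h1 := congrArg (ptr1 m n) h
  have h2 := congrArg (ptr2 m n) h
  rw [ptr1_kron, ptr1_kron, hA.2.2, hA'.2.2, one_smul, one_smul] at h1
  rw [ptr2_kron, ptr2_kron, hB.2.2, hB'.2.2, one_smul, one_smul] at h2
  exact ⟨h2, h1⟩

lemma surj_of_pure {p q : ℕ} (f : Matrix (Fin p) (Fin p) ℂ →ₗ[ℂ] Matrix (Fin q) (Fin q) ℂ)
    (h : ∀ P, IsPureState P → ∃ Q, f Q = P) : Function.Surjective f := by
  rw [← LinearMap.range_eq_top]
  apply span_pure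
  intro P hP
  exact h P hP

lemma dim_le {p q : ℕ} (f : Matrix (Fin p) (Fin p) ℂ →ₗ[ℂ] Matrix (Fin q) (Fin q) ℂ)
    (h : Function.Surjective f) : q ≤ p := by
  have := LinearMap.finrank_le_finrank_of_surjective h
  simp [Module.finrank_matrix] at this
  exact Nat.mul_self_le_mul_self_iff.1 this

lemma kron_ext {E : Type*} [AddCommGroup E] [Module ℂ E]
    (L L' : Matrix (Fin m) (Fin m) ℂ →ₗ[ℂ] Matrix (Fin n) (Fin n) ℂ →ₗ[ℂ] E)
    (h : ∀ P Q, IsPureState P → IsPureState Q → L P Q = L' P Q) : L = L' :=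
  lin_ext_eq _ _ fun P hP => lin_ext_eq _ _ fun Q hQ => h P Q hP hQ

lemma product_form (hm : 2 ≤ m) (hn : 2 ≤ n)
    (Ψ : Matrix (Fin m × Fin n) (Fin m × Fin n) ℂ →ₗ[ℂ] Matrix (Fin m × Fin n) (Fin m × Fin n) ℂ)
    (hinj : Function.Injective Ψ) (hpp : ∀ Y, IsPP Y → IsPP (Ψ Y))
    (hsurj : ∀ X, IsPP X → ∃ Y, IsPP Y ∧ Ψ Y = X) :
    (∃ (f : Matrix (Fin m) (Fin m) ℂ →ₗ[ℂ] Matrix (Fin m) (Fin m) ℂ)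
      (g : Matrix (Fin n) (Fin n) ℂ →ₗ[ℂ] Matrix (Fin n) (Fin n) ℂ),
      (∀ P, IsPureState P → IsPureState (f P)) ∧ (∀ P, IsPureState P → IsPureState (g P)) ∧
      Function.Surjective f ∧ Function.Surjective g ∧ ∀ A B, Ψ (A ⊗ₖ B) = f A ⊗ₖ g B) ∨
    (∃ (f : Matrix (Fin n) (Fin n) ℂ →ₗ[ℂ] Matrix (Fin m) (Fin m) ℂ)
      (g : Matrix (Fin m) (Fin m) ℂ →ₗ[ℂ] Matrix (Fin n) (Fin n) ℂ),
      (∀ P, IsPureState P → IsPureState (f P)) ∧ (∀ P, IsPureState P → IsPureState (g P)) ∧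
      Function.Surjective f ∧ Function.Surjective g ∧ ∀ A B, Ψ (A ⊗ₖ B) = f B ⊗ₖ g A) := by
  let F : Matrix (Fin m) (Fin m) ℂ →ₗ[ℂ] Matrix (Fin n) (Fin n) ℂ →ₗ[ℂ] Matrix (Fin m) (Fin m) ℂ :=
    (kb m n).compr₂ (ptr2 m n ∘ₗ Ψ)
  let G : Matrix (Fin m) (Fin m) ℂ →ₗ[ℂ] Matrix (Fin n) (Fin n) ℂ →ₗ[ℂ] Matrix (Fin n) (Fin n) ℂ :=
    (kb m n).compr₂ (ptr1 m n ∘ₗ Ψ)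
  have hF : ∀ A B, F A B = ptr2 m n (Ψ (A ⊗ₖ B)) := fun A B => rfl
  have hG : ∀ A B, G A B = ptr1 m n (Ψ (A ⊗ₖ B)) := fun A B => rfl
  have H : ∀ P Q, IsPureState P → IsPureState Q →
      IsPureState (F P Q) ∧ IsPureState (G P Q) ∧ Ψ (P ⊗ₖ Q) = F P Q ⊗ₖ G P Q := by
    intro P Q hP hQ
    obtain ⟨P', Q', hP', hQ', h⟩ := hpp _ ⟨P, Q, hP, hQ, rfl⟩
    rw [hF, hG, h, ptr1_kron, ptr2_kron, hP'.2.2, hQ'.2.2, one_smul, one_smul]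
    exact ⟨hP', hQ', rfl⟩
  obtain ⟨P₁, P₂, P₃, h12, h13, h23⟩ := three_pure m hm
  obtain ⟨Q₁, Q₂, Q₃, k12, -, -⟩ := three_pure n hn
  let F' : {P : Matrix (Fin m) (Fin m) ℂ // IsPureState P} →
    {P : Matrix (Fin n) (Fin n) ℂ // IsPureState P} →
    {P : Matrix (Fin m) (Fin m) ℂ // IsPureState P} := fun P Q => ⟨F P Q, (H P Q P.2 Q.2).1⟩
  let G' : {P : Matrix (Fin m) (Fin m) ℂ // IsPureState P} →
    {P : Matrix (Fin n) (Fin n) ℂ // IsPureState P} →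
    {P : Matrix (Fin n) (Fin n) ℂ // IsPureState P} := fun P Q => ⟨G P Q, (H P Q P.2 Q.2).2.1⟩
  have hs : ∀ c d, ∃ a b, F' a b = c ∧ G' a b = d := by
    intro c d
    obtain ⟨_, ⟨P, Q, hP, hQ, rfl⟩, h⟩ := hsurj _ ⟨c, d, c.2, d.2, rfl⟩
    have h1 := H P Q hP hQ
    have h2 := pure_kron_inj h1.1 h1.2.1 c.2 d.2 (h1.2.2.symm.trans h)
    exact ⟨⟨P, hP⟩, ⟨Q, hQ⟩, Subtype.ext h2.1, Subtype.ext h2.2⟩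
  have hc := comb F' G' ?_ hs ?_ ?_ P₁ P₂ P₃ h12 h13 h23 P₁ P₂ h12 Q₁ Q₂ k12
  · rcases hc with ⟨c1, c2⟩ | ⟨c1, c2⟩
    · left
      refine ⟨F.flip Q₁, G P₁, fun P hP => (H P Q₁ hP Q₁.2).1, fun Q hQ => (H P₁ Q P₁.2 hQ).2.1,
        ?_, ?_, ?_⟩
      · apply surj_of_pure
        intro P hP
        obtain ⟨a, b, h, -⟩ := hs ⟨P, hP⟩ Q₁
        rw [c1 a b Q₁] at h
        exact ⟨a, congrArg Subtype.val h⟩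
      · apply surj_of_pure
        intro Q hQ
        obtain ⟨a, b, -, h⟩ := hs P₁ ⟨Q, hQ⟩
        rw [c2 a P₁ b] at h
        exact ⟨b, congrArg Subtype.val h⟩
      · have := kron_ext ((kb m n).compr₂ Ψ) ((kb m n).compl₁₂ (F.flip Q₁) (G P₁)) ?_
        · intro A B
          exact LinearMap.congr_fun₂ this A B
        · intro P Q hP hQ
          have e1 : F P Q = F P Q₁ := congrArg Subtype.val (c1 ⟨P, hP⟩ ⟨Q, hQ⟩ Q₁)
          have e2 : G P Q = G P₁ Q := congrArg Subtype.val (c2 ⟨P, hP⟩ P₁ ⟨Q, hQ⟩)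
          have := (H P Q hP hQ).2.2
          rw [e1, e2] at this
          exact this
    · right
      refine ⟨F P₁, G.flip Q₁, fun Q hQ => (H P₁ Q P₁.2 hQ).1, fun P hP => (H P Q₁ hP Q₁.2).2.1,
        ?_, ?_, ?_⟩
      · apply surj_of_pure
        intro P hP
        obtain ⟨a, b, h, -⟩ := hs ⟨P, hP⟩ Q₁
        rw [c1 a P₁ b] at h
        exact ⟨b, congrArg Subtype.val h⟩
      · apply surj_of_pure
        intro Q hQ
        obtain ⟨a, b, -, h⟩ := hs P₁ ⟨Q, hQ⟩
        rw [c2 a b Q₁] at h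
        exact ⟨a, congrArg Subtype.val h⟩
      · have := kron_ext ((kb m n).compr₂ Ψ) ((kb m n).compl₁₂ (F P₁) (G.flip Q₁)).flip ?_
        · intro A B
          exact LinearMap.congr_fun₂ this A B
        · intro P Q hP hQ
          have e1 : F P Q = F P₁ Q := congrArg Subtype.val (c1 ⟨P, hP⟩ P₁ ⟨Q, hQ⟩)
          have e2 : G P Q = G P Q₁ := congrArg Subtype.val (c2 ⟨P, hP⟩ ⟨Q, hQ⟩ Q₁)
          have := (H P Q hP hQ).2.2
          rw [e1, e2] at this
          exact this
  · intro a b a' b' h1 h2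
    have h1' : F a b = F a' b' := congrArg Subtype.val h1
    have h2' : G a b = G a' b' := congrArg Subtype.val h2
    have := hinj (((H a b a.2 b.2).2.2).trans (by rw [h1', h2']; exact (H a' b' a'.2 b'.2).2.2.symm))
    have := pure_kron_inj a.2 b.2 a'.2 b'.2 this
    exact ⟨Subtype.ext this.1, Subtype.ext this.2⟩
  · intro b
    rcases matrix_dich (F.flip b) (G.flip b) (Ψ ∘ₗ (kb m n).flip b)
      (fun P hP => (H P b hP b.2).2.2.symm) with h | h
    · exact Or.inl fun a a' => Subtype.ext (h a a' a.2 a'.2)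
    · exact Or.inr fun a a' => Subtype.ext (h a a' a.2 a'.2)
  · intro a
    rcases matrix_dich (F a) (G a) (Ψ ∘ₗ (kb m n) a)
      (fun P hP => (H a P a.2 hP).2.2.symm) with h | h
    · exact Or.inl fun b b' => Subtype.ext (h b b' b.2 b'.2)
    · exact Or.inr fun b b' => Subtype.ext (h b b' b.2 b'.2)

end s7
end PNR

namespace PNR

lemma pure_conj {m : ℕ} {U : Matrix (Fin m) (Fin m) ℂ} (hU : Uᴴ * U = 1)
    {P : Matrix (Fin m) (Fin m) ℂ} (hP : IsPureState P) : IsPureState (U * P * Uᴴ) := by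
  obtain ⟨x, hx, rfl⟩ := exists_unit_of_pure hP
  have h : U * R x x * Uᴴ = R (U *ᵥ x) (U *ᵥ x) := by
    simp [R, mul_vecMulVec, vecMulVec_mul, star_mulVec]
  rw [h]
  apply pure_of_unit
  rw [star_mulVec, ← dotProduct_mulVec, mulVec_mulVec, hU, one_mulVec, hx]

lemma psi_facts {m : ℕ} {U : Matrix (Fin m) (Fin m) ℂ} (hU : U ∈ Matrix.unitaryGroup (Fin m) ℂ)
    {ψ : Matrix (Fin m) (Fin m) ℂ → Matrix (Fin m) (Fin m) ℂ}
    (h : (∀ X, ψ X = U * X * Uᴴ) ∨ (∀ X, ψ X = U * Xᵀ * Uᴴ)) :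
    (∀ P, IsPureState P → IsPureState (ψ P)) ∧
      (∀ P, IsPureState P → ∃ Q, IsPureState Q ∧ ψ Q = P) := by
  have h1 : Uᴴ * U = 1 := mem_unitaryGroup_iff'.1 hU
  have h2 : U * Uᴴ = 1 := mem_unitaryGroup_iff.1 hU
  have h3 : ∀ P, U * (Uᴴ * P * U) * Uᴴ = P := by
    intro P
    calc U * (Uᴴ * P * U) * Uᴴ = (U * Uᴴ) * P * (U * Uᴴ) := by simp only [mul_assoc]
      _ = P := by rw [h2, one_mul, mul_one]
  have h4 : ∀ P, IsPureState P → IsPureState (Uᴴ * P * U) := by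
    intro P hP
    have := pure_conj (U := Uᴴ) (by rw [conjTranspose_conjTranspose, h2]) hP
    rwa [conjTranspose_conjTranspose] at this
  rcases h with h | h
  · exact ⟨fun P hP => by rw [h]; exact pure_conj h1 hP,
      fun P hP => ⟨_, h4 P hP, by rw [h, h3]⟩⟩
  · exact ⟨fun P hP => by rw [h]; exact pure_conj h1 (pure_transpose hP),
      fun P hP => ⟨_, pure_transpose (h4 P hP), by rw [h, transpose_transpose, h3]⟩⟩

lemma range_eq {m n : ℕ} {Ψ ΨStar : Matrix (Fin m × Fin n) (Fin m × Fin n) ℂ →ₗ[ℂ]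
        Matrix (Fin m × Fin n) (Fin m × Fin n) ℂ}
    (hadj : ∀ X Y, (Ψ X * Yᴴ).trace = (X * (ΨStar Y)ᴴ).trace)
    (hpp : ∀ Y, IsPP Y → IsPP (Ψ Y)) (hsurj : ∀ X, IsPP X → ∃ Y, IsPP Y ∧ Ψ Y = X)
    (T : Matrix (Fin m × Fin n) (Fin m × Fin n) ℂ) :
    prodNumRange (ΨStar T) = prodNumRange T := by
  ext z
  rw [range_iff, range_iff]
  constructor
  · rintro ⟨X, hX, rfl⟩
    refine ⟨Ψ X, hpp X hX, ?_⟩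
    rw [adj_star hadj T X hX, (hpp X hX).herm]
  · rintro ⟨X, hX, rfl⟩
    obtain ⟨Y, hY, rfl⟩ := hsurj X hX
    refine ⟨Y, hY, ?_⟩
    rw [adj_star hadj T Y hY, hX.herm]

end PNR


/-- Theorem 4.1: for a `ℂ`-linear map `Ψ` on `M_{mn}` with adjoint `Ψ*` (with respect to
`⟨X, Y⟩ = tr (XY*)`), the following are equivalent: (a) `W^⊗(Ψ*(T)) = W^⊗(T)` for all `T`;
(b) `conv W^⊗(Ψ*(T)) = conv W^⊗(T)` for all `T`; (c) there are unitary `U ∈ M_m`,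
`V ∈ M_n` such that either `Ψ(A ⊗ B) = ψ₁(A) ⊗ ψ₂(B)` for all `A, B`, or `m = n` and
`Ψ(A ⊗ B) = ψ₂(B) ⊗ ψ₁(A)` for all `A, B`, where `ψ₁` is `A ↦ UAU*` or `A ↦ UAᵀU*` and
`ψ₂` is `B ↦ VBV*` or `B ↦ VBᵀV*`. -/
theorem prodNumRange_preserver_form (m n : ℕ) (hm : 2 ≤ m) (hn : 2 ≤ n)
    (Ψ ΨStar : Matrix (Fin m × Fin n) (Fin m × Fin n) ℂ →ₗ[ℂ]
        Matrix (Fin m × Fin n) (Fin m × Fin n) ℂ)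
    (hadj : ∀ X Y, (Ψ X * Yᴴ).trace = (X * (ΨStar Y)ᴴ).trace) :
    [(∀ T, prodNumRange (ΨStar T) = prodNumRange T),
     (∀ T, convexHull ℝ (prodNumRange (ΨStar T)) = convexHull ℝ (prodNumRange T)),
     (∃ (U : Matrix (Fin m) (Fin m) ℂ) (V : Matrix (Fin n) (Fin n) ℂ)
        (ψ₁ : Matrix (Fin m) (Fin m) ℂ → Matrix (Fin m) (Fin m) ℂ)
        (ψ₂ : Matrix (Fin n) (Fin n) ℂ → Matrix (Fin n) (Fin n) ℂ),
        U ∈ Matrix.unitaryGroup (Fin m) ℂ ∧ V ∈ Matrix.unitaryGroup (Fin n) ℂ ∧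
        ((∀ X, ψ₁ X = U * X * Uᴴ) ∨ (∀ X, ψ₁ X = U * Xᵀ * Uᴴ)) ∧
        ((∀ X, ψ₂ X = V * X * Vᴴ) ∨ (∀ X, ψ₂ X = V * Xᵀ * Vᴴ)) ∧
        ((∀ (A : Matrix (Fin m) (Fin m) ℂ) (B : Matrix (Fin n) (Fin n) ℂ),
            Ψ (A ⊗ₖ B) = ψ₁ A ⊗ₖ ψ₂ B) ∨
         (∃ h : m = n, ∀ (A : Matrix (Fin m) (Fin m) ℂ) (B : Matrix (Fin n) (Fin n) ℂ),
            ∀ p q : Fin m × Fin n,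
              Ψ (A ⊗ₖ B) p q =
                ψ₂ B (Fin.cast h p.1) (Fin.cast h q.1) *
                  ψ₁ A (Fin.cast h.symm p.2) (Fin.cast h.symm q.2))))].TFAE := by
  tfae_have 1 → 2 := by
    intro h T
    rw [h T]
  tfae_have 2 → 3 := by
    intro hb
    obtain ⟨hinj, hpp⟩ := PNR.pp_bij hadj hb
    rcases PNR.product_form hm hn Ψ hinj hpp (PNR.pp_preimage hadj hb) with
      ⟨f, g, hf, hg, sf, sg, h⟩ | ⟨f, g, hf, hg, sf, sg, h⟩
    · obtain ⟨U, hU, h1⟩ := PNR.wigner (by omega) f hf (LinearMap.injective_iff_surjective.2 sf)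
      obtain ⟨V, hV, h2⟩ := PNR.wigner (by omega) g hg (LinearMap.injective_iff_surjective.2 sg)
      exact ⟨U, V, f, g, hU, hV, h1, h2, Or.inl h⟩
    · have hmn : m = n := le_antisymm (PNR.dim_le f sf) (PNR.dim_le g sg)
      subst hmn
      obtain ⟨V, hV, h2⟩ := PNR.wigner (by omega) f hf (LinearMap.injective_iff_surjective.2 sf)
      obtain ⟨U, hU, h1⟩ := PNR.wigner (by omega) g hg (LinearMap.injective_iff_surjective.2 sg)
      refine ⟨U, V, g, f, hU, hV, h1, h2, Or.inr ⟨rfl, ?_⟩⟩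
      intro A B p q
      rw [h]
      rfl
  tfae_have 3 → 1 := by
    rintro ⟨U, V, ψ₁, ψ₂, hU, hV, h1, h2, h⟩
    obtain ⟨a1, b1⟩ := PNR.psi_facts hU h1
    obtain ⟨a2, b2⟩ := PNR.psi_facts hV h2
    rcases h with h | ⟨hmn, h⟩
    · apply PNR.range_eq hadj
      · rintro _ ⟨P, Q, hP, hQ, rfl⟩
        exact ⟨_, _, a1 P hP, a2 Q hQ, h P Q⟩
      · rintro _ ⟨P, Q, hP, hQ, rfl⟩
        obtain ⟨P', hP', rfl⟩ := b1 P hP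
        obtain ⟨Q', hQ', rfl⟩ := b2 Q hQ
        exact ⟨_, ⟨P', Q', hP', hQ', rfl⟩, h P' Q'⟩
    · subst hmn
      have h' : ∀ A B, Ψ (A ⊗ₖ B) = ψ₂ B ⊗ₖ ψ₁ A := by
        intro A B
        ext p q
        rw [h]
        rfl
      apply PNR.range_eq hadj
      · rintro _ ⟨P, Q, hP, hQ, rfl⟩
        exact ⟨_, _, a2 Q hQ, a1 P hP, h' P Q⟩
      · rintro _ ⟨P, Q, hP, hQ, rfl⟩
        obtain ⟨P', hP', rfl⟩ := b2 P hP
        obtain ⟨Q', hQ', rfl⟩ := b1 Q hQ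
        exact ⟨_, ⟨Q', P', hQ', hP', rfl⟩, h' Q' P'⟩
  tfae_finish
end
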